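/- arXiv:1301.5613 — 4 statements merged into one kernel-verified Lean document; each statement's English description precedes it below -/
import Mathlib

section
/- Let d ≥ 1 and let S be a subsemigroup of ℤ^d × ℕ satisfying condition (A) and condition (B). Then lim_{n→∞} #S_n/n^d = vol(Δ(S)). -/
open Filter Topology

/-- The slice `S_n = {x ∈ ℤ^d : (x,n) ∈ S}` of a subset `S ⊆ ℤ^d × ℕ`. -/
def sgSlice {d : ℕ} (S : Set ((Fin d → ℤ) × ℕ)) (n : ℕ) : Set (Fin d → ℤ) :=
  {x | (x, n) ∈ S}

/-- The canonical map `ℤ^d × ℕ → ℝ^d × ℝ`. -/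
def sgEmb {d : ℕ} (p : (Fin d → ℤ) × ℕ) : (Fin d → ℝ) × ℝ :=
  (fun i => (p.1 i : ℝ), (p.2 : ℝ))

/-- `Con(S)`: the closed convex cone generated by `S`, i.e. the closure of the set of
nonnegative real linear combinations of elements of `S`. -/
def sgCone {d : ℕ} (S : Set ((Fin d → ℤ) × ℕ)) : Set ((Fin d → ℝ) × ℝ) :=
  closure {z | ∃ (m : ℕ) (c : Fin m → ℝ) (v : Fin m → ((Fin d → ℤ) × ℕ)),
    (∀ i, 0 ≤ c i) ∧ (∀ i, v i ∈ S) ∧ z = ∑ i, c i • sgEmb (v i)}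

/-- The Newton–Okounkov body `Δ(S) = {x ∈ ℝ^d : (x,1) ∈ Con(S)}`. -/
def sgBody {d : ℕ} (S : Set ((Fin d → ℤ) × ℕ)) : Set (Fin d → ℝ) :=
  {x | (x, (1 : ℝ)) ∈ sgCone S}

/-- Condition (A): there are finitely many `v_1,…,v_r ∈ ℕ^d` such that `S` is contained in the
subsemigroup of `ℕ^{d+1}` generated by `(v_1,1),…,(v_r,1)`. -/
def sgCondA {d : ℕ} (S : Set ((Fin d → ℤ) × ℕ)) : Prop :=
  ∃ (r : ℕ) (v : Fin r → (Fin d → ℕ)),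
    S ⊆ (AddSubsemigroup.closure
      (Set.range fun j => ((fun i => (v j i : ℤ), 1) : (Fin d → ℤ) × ℕ)) : Set _)

/-- Condition (B): the subgroup of `ℤ^{d+1}` generated by `S` is all of `ℤ^{d+1}`. -/
def sgCondB {d : ℕ} (S : Set ((Fin d → ℤ) × ℕ)) : Prop :=
  AddSubgroup.closure ((fun p : (Fin d → ℤ) × ℕ => ((p.1, (p.2 : ℤ)) : (Fin d → ℤ) × ℤ)) '' S)
    = ⊤

open MeasureTheory Bornology

open scoped Pointwise

section LatticePoints

variable {d : ℕ}

/-- The integer points of the dilate `n • B`. -/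
def dilateLatticePoints (B : Set (Fin d → ℝ)) (n : ℕ) : Set (Fin d → ℤ) :=
  {x | (fun i => (x i : ℝ) / n) ∈ B}

theorem dilateLatticePoints_finite {B : Set (Fin d → ℝ)} (hB : IsBounded B) {n : ℕ}
    (hn : n ≠ 0) : (dilateLatticePoints B n).Finite := by
  obtain ⟨R, hR⟩ := hB.exists_norm_le
  refine (Set.finite_Icc (fun _ => -⌈R * n⌉) (fun _ => ⌈R * n⌉)).subset fun x hx => ?_
  have hn' : (0 : ℝ) < n := by positivity
  have key : ∀ i, |(x i : ℝ)| ≤ R * n := fun i => by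
    have h := (norm_le_pi_norm _ i).trans (hR _ hx)
    rwa [Real.norm_eq_abs, abs_div, abs_of_pos hn', div_le_iff₀ hn'] at h
  refine ⟨fun i => ?_, fun i => ?_⟩
  · have := (abs_le.1 (key i)).1
    have h2 := Int.le_ceil (R * n)
    have : (-⌈R * n⌉ : ℝ) ≤ x i := by linarith
    exact_mod_cast this
  · have := (abs_le.1 (key i)).2
    have h2 := Int.le_ceil (R * n)
    have : (x i : ℝ) ≤ ⌈R * n⌉ := by linarith
    exact_mod_cast this

theorem ncard_dilateLatticePoints (B : Set (Fin d → ℝ)) {n : ℕ} (hn : n ≠ 0) :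
    (dilateLatticePoints B n).ncard =
      Nat.card ↑(B ∩ (n : ℝ)⁻¹ • (Submodule.span ℤ (Set.range (Pi.basisFun ℝ (Fin d))) :
        Set (Fin d → ℝ))) := by
  have hn' : (n : ℝ) ≠ 0 := by exact_mod_cast hn
  have : NeZero n := ⟨hn⟩
  have hinj : Function.Injective fun (x : Fin d → ℤ) (i : Fin d) => (x i : ℝ) / n := by
    intro x y h
    funext i
    have := congrFun h i
    simp only at this
    rw [div_left_inj' hn'] at this
    exact_mod_cast this
  rw [← Set.ncard_image_of_injective _ hinj, Nat.card_coe_set_eq]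
  congr 1
  ext y
  have hmem := BoxIntegral.unitPartition.mem_smul_span_iff (n := n) (v := y)
  rw [← SetLike.mem_coe, Submodule.coe_pointwise_smul] at hmem
  rw [Set.mem_inter_iff, hmem]
  constructor
  · rintro ⟨x, hx, rfl⟩
    refine ⟨hx, fun i => ⟨x i, ?_⟩⟩
    simp only [algebraMap_int_eq, eq_intCast]
    field_simp
  · rintro ⟨hy, h⟩
    choose x hx using h
    have hxy : (fun i => (x i : ℝ) / n) = y := by
      funext i
      have := hx i
      simp only [algebraMap_int_eq, eq_intCast] at this
      rw [this]
      field_simp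
    exact ⟨x, by rwa [dilateLatticePoints, Set.mem_ofPred_eq, hxy], hxy⟩

theorem tendsto_ncard_dilateLatticePoints {B : Set (Fin d → ℝ)} (hb : IsBounded B)
    (hm : MeasurableSet B) (hf : volume (frontier B) = 0) :
    Tendsto (fun n : ℕ => ((dilateLatticePoints B n).ncard : ℝ) / (n : ℝ) ^ d) atTop
      (𝓝 (volume.real B)) := by
  have h := tendsto_card_div_pow_atTop_volume B hb hm hf
  rw [Fintype.card_fin] at h
  refine h.congr' ?_
  filter_upwards [eventually_ne_atTop 0] with n hn
  rw [ncard_dilateLatticePoints B hn]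

end LatticePoints

section FiniteCone

variable {d : ℕ}

/-- The inclusion `ℤ^d × ℕ → ℤ^d × ℤ`. -/
def sgToInt (d : ℕ) : (Fin d → ℤ) × ℕ →+ (Fin d → ℤ) × ℤ :=
  (AddMonoidHom.id _).prodMap (Nat.castAddMonoidHom ℤ)

theorem sgToInt_injective : Function.Injective (sgToInt d) := by
  rintro ⟨x, m⟩ ⟨y, n⟩ h
  simpa [sgToInt] using h

/-- The real cone generated by a finite set of integer points. -/
def finCone (T : Finset ((Fin d → ℤ) × ℕ)) : Set ((Fin d → ℝ) × ℝ) :=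
  {z | ∃ c : (Fin d → ℤ) × ℕ → ℝ, (∀ g, 0 ≤ c g) ∧ z = ∑ g ∈ T, c g • sgEmb g}

/-- The slice at height one of the cone generated by a finite set of integer points. -/
def finSlice (T : Finset ((Fin d → ℤ) × ℕ)) : Set (Fin d → ℝ) :=
  {x | (x, (1 : ℝ)) ∈ finCone T}

theorem finCone_smul_mem {T : Finset ((Fin d → ℤ) × ℕ)} {z : (Fin d → ℝ) × ℝ}
    (hz : z ∈ finCone T) {t : ℝ} (ht : 0 ≤ t) : t • z ∈ finCone T := by
  obtain ⟨c, hc, rfl⟩ := hz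
  exact ⟨fun g => t * c g, fun g => mul_nonneg ht (hc g), by
    simp only [Finset.smul_sum, smul_smul]⟩

theorem finCone_add_mem {T : Finset ((Fin d → ℤ) × ℕ)} {z w : (Fin d → ℝ) × ℝ}
    (hz : z ∈ finCone T) (hw : w ∈ finCone T) : z + w ∈ finCone T := by
  obtain ⟨c, hc, rfl⟩ := hz
  obtain ⟨e, he, rfl⟩ := hw
  exact ⟨fun g => c g + e g, fun g => add_nonneg (hc g) (he g), by
    simp only [add_smul, Finset.sum_add_distrib]⟩

theorem finCone_mono {T U : Finset ((Fin d → ℤ) × ℕ)} (h : T ⊆ U) :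
    finCone T ⊆ finCone U := by
  classical
  rintro z ⟨c, hc, rfl⟩
  refine ⟨fun g => if g ∈ T then c g else 0, fun g => ?_, ?_⟩
  · dsimp only
    split_ifs
    exacts [hc g, le_rfl]
  simp only [ite_smul, zero_smul, Finset.sum_ite_mem]
  rw [Finset.inter_eq_right.2 h]

theorem finSlice_mono {T U : Finset ((Fin d → ℤ) × ℕ)} (h : T ⊆ U) :
    finSlice T ⊆ finSlice U := fun _ hx => finCone_mono h hx

theorem convex_finSlice (T : Finset ((Fin d → ℤ) × ℕ)) : Convex ℝ (finSlice T) := by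
  intro x hx y hy a b ha hb hab
  have h := finCone_add_mem (finCone_smul_mem hx ha) (finCone_smul_mem hy hb)
  simpa [finSlice, hab] using h

theorem sum_nsmul_mem_of_pos {M : Type*} [AddCommMonoid M] {S : Set M}
    (hadd : ∀ x ∈ S, ∀ y ∈ S, x + y ∈ S) {T : Finset M} (hT : ↑T ⊆ S) (hne : T.Nonempty)
    {c : M → ℕ} (hc : ∀ g ∈ T, 0 < c g) : ∑ g ∈ T, c g • g ∈ S := by
  refine Finset.sum_induction_nonempty _ (· ∈ S) (fun a b ha hb => hadd a ha b hb) hne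
    fun g hg => ?_
  have hgS := hT hg
  induction c g, Nat.succ_le_of_lt (hc g hg) using Nat.le_induction with
  | base => simpa using hgS
  | succ k _ ih => rw [succ_nsmul]; exact hadd _ ih _ hgS

/-- If a finite subset `T` of the semigroup `S` generates `ℤ^{d+1}`, then some translate of the
set of integer points in the cone of `T` is contained in `S`. -/
theorem exists_add_mem_of_mem_finCone {S : Set ((Fin d → ℤ) × ℕ)}
    (hadd : ∀ x ∈ S, ∀ y ∈ S, x + y ∈ S) {T : Finset ((Fin d → ℤ) × ℕ)} (hT : ↑T ⊆ S)
    (hspan : Submodule.span ℤ (sgToInt d '' T) = ⊤) :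
    ∃ γ : (Fin d → ℤ) × ℕ, ∀ p, sgEmb p ∈ finCone T → p + γ ∈ S := by
  classical
  have hne : T.Nonempty := by
    by_contra h
    rw [Finset.not_nonempty_iff_eq_empty] at h
    subst h
    simp at hspan
  have hrep : ∀ b : (Fin d → ℤ) × ℤ, ∃ m : (Fin d → ℤ) × ℕ → ℤ,
      ∑ g ∈ T, m g • sgToInt d g = b := fun b =>
    (Submodule.mem_span_image_finset_iff_exists_fun' ℤ).1 (hspan ▸ Submodule.mem_top)
  choose m hm using hrep
  set R : (Fin d → ℤ) × ℤ := (fun i => ∑ g ∈ T, |g.1 i|, ∑ g ∈ T, (g.2 : ℤ)) with hR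
  obtain ⟨M, hM⟩ : ∃ M : ℕ, ∀ b ∈ Set.Icc (-R) R, ∀ g ∈ T, -(M : ℤ) ≤ m b g := by
    obtain ⟨M, hM⟩ := ((Set.finite_Icc (-R) R).image2 (fun b g => (m b g).natAbs)
      T.finite_toSet).bddAbove
    refine ⟨M, fun b hb g hg => ?_⟩
    have : (m b g).natAbs ≤ M := hM ⟨b, hb, g, hg, rfl⟩
    omega
  refine ⟨∑ g ∈ T, (M + 1) • g, fun p ⟨c, hc, hp⟩ => ?_⟩
  have hp1 : ∀ i, (p.1 i : ℝ) = ∑ g ∈ T, c g * g.1 i := fun i => by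
    have := congrFun (congrArg Prod.fst hp) i
    simpa [sgEmb, Prod.fst_sum, Finset.sum_apply] using this
  have hp2 : (p.2 : ℝ) = ∑ g ∈ T, c g * g.2 := by
    have := congrArg Prod.snd hp
    simpa [sgEmb, Prod.snd_sum] using this
  have hfract : ∀ (a : ℝ) (f : (Fin d → ℤ) × ℕ → ℤ), a = ∑ g ∈ T, c g * f g →
      |a - ∑ g ∈ T, (⌊c g⌋ : ℝ) * f g| ≤ ∑ g ∈ T, |(f g : ℝ)| := by
    rintro a f rfl
    rw [← Finset.sum_sub_distrib]
    refine (Finset.abs_sum_le_sum_abs _ _).trans (Finset.sum_le_sum fun g _ => ?_)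
    rw [← sub_mul, abs_mul, Int.self_sub_floor, abs_of_nonneg (Int.fract_nonneg _)]
    exact mul_le_of_le_one_left (abs_nonneg _) (Int.fract_lt_one _).le
  set b := sgToInt d p - ∑ g ∈ T, ⌊c g⌋ • sgToInt d g with hb
  have hb1 : ∀ i, |b.1 i| ≤ R.1 i := fun i => by
    have := hfract _ (fun g => g.1 i) (hp1 i)
    have hbi : b.1 i = p.1 i - ∑ g ∈ T, ⌊c g⌋ * g.1 i := by
      simp [hb, sgToInt, Prod.fst_sum, Finset.sum_apply]
    rw [hbi]
    exact_mod_cast this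
  have hb2 : |b.2| ≤ R.2 := by
    have := hfract p.2 (fun g => (g.2 : ℤ)) (by simpa using hp2)
    have hbi : b.2 = p.2 - ∑ g ∈ T, ⌊c g⌋ * (g.2 : ℤ) := by
      simp [hb, sgToInt, Prod.snd_sum]
    rw [hbi]
    change _ ≤ ∑ g ∈ T, (g.2 : ℤ)
    simp only [Int.cast_natCast, Nat.abs_cast] at this
    exact_mod_cast this
  have hbR : b ∈ Set.Icc (-R) R :=
    ⟨⟨fun i => (abs_le.1 (hb1 i)).1, (abs_le.1 hb2).1⟩,
      ⟨fun i => (abs_le.1 (hb1 i)).2, (abs_le.1 hb2).2⟩⟩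
  have hcoef : ∀ g ∈ T, 0 < ⌊c g⌋ + m b g + (M + 1) := fun g hg => by
    have h1 := hM b hbR g hg
    have h2 := Int.floor_nonneg.2 (hc g)
    omega
  have heq : p + ∑ g ∈ T, (M + 1) • g = ∑ g ∈ T, (⌊c g⌋ + m b g + (M + 1)).toNat • g := by
    apply sgToInt_injective
    have hr : sgToInt d (∑ g ∈ T, (⌊c g⌋ + m b g + (M + 1)).toNat • g) =
        ∑ g ∈ T, (⌊c g⌋ + m b g + (M + 1)) • sgToInt d g := by
      rw [map_sum]
      refine Finset.sum_congr rfl fun g hg => ?_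
      rw [map_nsmul, ← natCast_zsmul, Int.toNat_of_nonneg (hcoef g hg).le]
    have hl : sgToInt d (∑ g ∈ T, (M + 1) • g) =
        ∑ g ∈ T, ((M : ℤ) + 1) • sgToInt d g := by
      rw [map_sum]
      refine Finset.sum_congr rfl fun g hg => ?_
      rw [map_nsmul, ← natCast_zsmul, Nat.cast_succ]
    rw [map_add, hr, hl]
    simp only [add_smul _ ((M : ℤ) + 1), Finset.sum_add_distrib]
    rw [add_left_inj]
    simp only [add_smul, Finset.sum_add_distrib, hm b]
    rw [hb]
    abel
  rw [heq]
  exact sum_nsmul_mem_of_pos hadd hT hne fun g hg => by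
    have := hcoef g hg
    omega

theorem exists_finset_span_eq_top {S : Set ((Fin d → ℤ) × ℕ)} (hB : sgCondB S) :
    ∃ T : Finset ((Fin d → ℤ) × ℕ), ↑T ⊆ S ∧ Submodule.span ℤ (sgToInt d '' T) = ⊤ := by
  classical
  have htop : Submodule.span ℤ (sgToInt d '' S) = ⊤ := by
    rw [← Submodule.toAddSubgroup_inj, Submodule.span_int_eq_addSubgroupClosure]
    exact hB
  obtain ⟨U, hU, hUS⟩ := (Submodule.fg_span_iff_fg_span_finset_subset (sgToInt d '' S)).1
    (htop ▸ Module.Finite.fg_top)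
  obtain ⟨T, hT, rfl⟩ := Finset.subset_set_image_iff.1 hU
  exact ⟨T, hT, by rw [← Finset.coe_image, ← hUS, htop]⟩

end FiniteCone

section Body

variable {d : ℕ}

theorem finSlice_subset_sgBody {S : Set ((Fin d → ℤ) × ℕ)} {T : Finset ((Fin d → ℤ) × ℕ)}
    (hT : ↑T ⊆ S) : finSlice T ⊆ sgBody S := by
  rintro x ⟨c, hc, hx⟩
  refine subset_closure ⟨T.card, fun i => c (T.equivFin.symm i), fun i => T.equivFin.symm i,
    fun i => hc _, fun i => hT (T.equivFin.symm i).2, ?_⟩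
  rw [hx, ← Finset.sum_coe_sort T,
    Equiv.sum_comp T.equivFin.symm (fun g : T => c g • sgEmb (g : (Fin d → ℤ) × ℕ))]

theorem sgBody_subset_closure_iUnion (S : Set ((Fin d → ℤ) × ℕ)) :
    sgBody S ⊆ closure (⋃ T : {T : Finset ((Fin d → ℤ) × ℕ) // ↑T ⊆ S}, finSlice T.1) := by
  classical
  intro x hx
  have hpos : ∀ᶠ z : (Fin d → ℝ) × ℝ in 𝓝 (x, 1), 0 < z.2 :=
    continuous_snd.continuousAt.eventually (lt_mem_nhds (by simp))
  have hfreq := (mem_closure_iff_frequently.1 hx).and_eventually hpos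
  have hcont : Tendsto (fun z : (Fin d → ℝ) × ℝ => z.2⁻¹ • z.1) (𝓝 (x, 1)) (𝓝 x) := by
    have : ContinuousAt (fun z : (Fin d → ℝ) × ℝ => z.2⁻¹ • z.1) (x, 1) :=
      (continuousAt_snd.inv₀ (by simp)).smul continuousAt_fst
    simpa [ContinuousAt] using this
  refine mem_closure_iff_frequently.2 (hcont.frequently (hfreq.mono ?_))
  rintro z ⟨⟨m, c, v, hc, hv, hz⟩, hz0⟩
  refine Set.mem_iUnion.2 ⟨⟨Finset.univ.image v, by simpa [Set.range_subset_iff] using hv⟩, ?_⟩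
  have hcone : z ∈ finCone (Finset.univ.image v) := by
    refine ⟨fun g => ∑ i with v i = g, c i, fun g => Finset.sum_nonneg fun i _ => hc i, ?_⟩
    rw [hz, ← Finset.sum_fiberwise_of_maps_to (t := Finset.univ.image v) (g := v)
      (fun i _ => Finset.mem_image_of_mem v (Finset.mem_univ i))]
    refine Finset.sum_congr rfl fun g _ => ?_
    rw [Finset.sum_smul]
    refine Finset.sum_congr rfl fun i hi => ?_
    rw [(Finset.mem_filter.1 hi).2]
  have h := finCone_smul_mem hcone (inv_nonneg.2 hz0.le)
  have he : z.2⁻¹ • z = (z.2⁻¹ • z.1, (1 : ℝ)) := by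
    ext
    · rfl
    · simp [hz0.ne']
  rwa [he] at h

theorem isClosed_sgBody (S : Set ((Fin d → ℤ) × ℕ)) : IsClosed (sgBody S) :=
  isClosed_closure.preimage (by fun_prop : Continuous fun x : Fin d → ℝ => (x, (1 : ℝ)))

theorem directed_finSlice (S : Set ((Fin d → ℤ) × ℕ)) :
    Directed (· ⊆ ·)
      fun T : {T : Finset ((Fin d → ℤ) × ℕ) // ↑T ⊆ S} => finSlice T.1 := by
  classical
  intro T U
  exact ⟨⟨T.1 ∪ U.1, by simpa using ⟨T.2, U.2⟩⟩, finSlice_mono Finset.subset_union_left,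
    finSlice_mono Finset.subset_union_right⟩

theorem sgBody_eq_closure_iUnion (S : Set ((Fin d → ℤ) × ℕ)) :
    sgBody S = closure (⋃ T : {T : Finset ((Fin d → ℤ) × ℕ) // ↑T ⊆ S}, finSlice T.1) :=
  (sgBody_subset_closure_iUnion S).antisymm <| closure_minimal
    (Set.iUnion_subset fun T => finSlice_subset_sgBody T.2) (isClosed_sgBody S)

theorem convex_iUnion_finSlice (S : Set ((Fin d → ℤ) × ℕ)) :
    Convex ℝ (⋃ T : {T : Finset ((Fin d → ℤ) × ℕ) // ↑T ⊆ S}, finSlice T.1) :=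
  (directed_finSlice S).convex_iUnion fun T => convex_finSlice T.1

theorem convex_sgBody (S : Set ((Fin d → ℤ) × ℕ)) : Convex ℝ (sgBody S) := by
  rw [sgBody_eq_closure_iUnion]
  exact (convex_iUnion_finSlice S).closure

theorem volume_sgBody (S : Set ((Fin d → ℤ) × ℕ)) :
    volume (sgBody S) =
      ⨆ T : {T : Finset ((Fin d → ℤ) × ℕ) // ↑T ⊆ S}, volume (finSlice T.1) := by
  rw [sgBody_eq_closure_iUnion, measure_closure_of_null_frontier
    ((convex_iUnion_finSlice S).addHaar_frontier volume), (directed_finSlice S).measure_iUnion]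

theorem exists_bound_of_sgCondA {S : Set ((Fin d → ℤ) × ℕ)} (hA : sgCondA S) :
    ∃ C : ℕ, ∀ p ∈ S, 0 < p.2 ∧ ∀ i, 0 ≤ p.1 i ∧ p.1 i ≤ C * p.2 := by
  obtain ⟨r, v, hv⟩ := hA
  refine ⟨∑ j, ∑ i, v j i, fun p hp => ?_⟩
  have hp' := hv hp
  clear hp
  induction hp' using AddSubsemigroup.closure_induction with
  | mem x hx =>
    obtain ⟨j, rfl⟩ := hx
    refine ⟨one_pos, fun i => ⟨by positivity, ?_⟩⟩
    have h1 := Finset.single_le_sum (f := v j) (fun _ _ => Nat.zero_le _) (Finset.mem_univ i)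
    have h2 := Finset.single_le_sum (f := fun j => ∑ i, v j i) (fun _ _ => Nat.zero_le _)
      (Finset.mem_univ j)
    simp only [Nat.cast_one, mul_one]
    exact_mod_cast h1.trans h2
  | add x y _ _ hx hy =>
    refine ⟨Nat.add_pos_left hx.1 _, fun i => ⟨add_nonneg (hx.2 i).1 (hy.2 i).1, ?_⟩⟩
    have := add_le_add (hx.2 i).2 (hy.2 i).2
    simpa [mul_add] using this

theorem isBounded_sgBody {S : Set ((Fin d → ℤ) × ℕ)} (hA : sgCondA S) :
    IsBounded (sgBody S) := by
  obtain ⟨C, hC⟩ := exists_bound_of_sgCondA hA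
  refine (Metric.isBounded_Icc (0 : Fin d → ℝ) fun _ => (C : ℝ)).subset fun x hx => ?_
  have hclosed : IsClosed {z : (Fin d → ℝ) × ℝ | ∀ i, 0 ≤ z.1 i ∧ z.1 i ≤ C * z.2} := by
    simp only [Set.ofPred_forall, Set.ofPred_and]
    exact isClosed_iInter fun i => (isClosed_le (by fun_prop) (by fun_prop)).inter
      (isClosed_le (by fun_prop) (by fun_prop))
  have h := closure_minimal (t := {z : (Fin d → ℝ) × ℝ | ∀ i, 0 ≤ z.1 i ∧ z.1 i ≤ C * z.2})
    ?_ hclosed hx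
  · exact ⟨fun i => (h i).1, fun i => by simpa using (h i).2⟩
  · rintro z ⟨m, c, v, hc, hv, rfl⟩ i
    simp only [Prod.fst_sum, Prod.snd_sum, Finset.sum_apply, Prod.smul_fst, Prod.smul_snd,
      Pi.smul_apply, smul_eq_mul, sgEmb, Finset.mul_sum]
    refine ⟨Finset.sum_nonneg fun j _ => mul_nonneg (hc j) ?_, Finset.sum_le_sum fun j _ => ?_⟩
    · exact_mod_cast ((hC _ (hv j)).2 i).1
    · rw [mul_left_comm]
      refine mul_le_mul_of_nonneg_left ?_ (hc j)
      exact_mod_cast ((hC _ (hv j)).2 i).2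

theorem sgSlice_subset_dilateLatticePoints (S : Set ((Fin d → ℤ) × ℕ)) {n : ℕ} (hn : n ≠ 0) :
    sgSlice S n ⊆ dilateLatticePoints (sgBody S) n := by
  intro x hx
  refine subset_closure ⟨1, fun _ => (n : ℝ)⁻¹, fun _ => (x, n), fun _ => by positivity,
    fun _ => hx, ?_⟩
  have hn' : (n : ℝ) ≠ 0 := by exact_mod_cast hn
  ext
  · simp [sgEmb, div_eq_inv_mul]
  · simp [sgEmb, hn']

theorem finite_sgSlice {S : Set ((Fin d → ℤ) × ℕ)} (hA : sgCondA S) {n : ℕ} (hn : n ≠ 0) :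
    (sgSlice S n).Finite :=
  (dilateLatticePoints_finite (isBounded_sgBody hA) hn).subset
    (sgSlice_subset_dilateLatticePoints S hn)

/-- Asymptotically, a semigroup has at least as many points at height `n` as there are integer
points in the dilates of the slice of the cone of any finite generating subset. -/
theorem eventually_lt_ncard_sgSlice {S : Set ((Fin d → ℤ) × ℕ)}
    (hadd : ∀ x ∈ S, ∀ y ∈ S, x + y ∈ S) (hA : sgCondA S) {T : Finset ((Fin d → ℤ) × ℕ)}
    (hT : ↑T ⊆ S) (hspan : Submodule.span ℤ (sgToInt d '' T) = ⊤) {a : ℝ}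
    (ha : a < volume.real (finSlice T)) :
    ∀ᶠ n : ℕ in atTop, a < ((sgSlice S n).ncard : ℝ) / (n : ℝ) ^ d := by
  obtain ⟨γ, hγ⟩ := exists_add_mem_of_mem_finCone hadd hT hspan
  have hconv := convex_finSlice T
  have hlim := tendsto_ncard_dilateLatticePoints
    ((isBounded_sgBody hA).subset (interior_subset.trans (finSlice_subset_sgBody hT)))
    isOpen_interior.measurableSet (hconv.interior.addHaar_frontier volume)
  have hvol : volume.real (interior (finSlice T)) = volume.real (finSlice T) := by
    simp only [Measure.real,
      measure_interior_of_null_frontier (hconv.addHaar_frontier volume)]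
  rw [hvol] at hlim
  have hratio : Tendsto (fun m : ℕ => ((m : ℝ) / ((m : ℝ) + γ.2)) ^ d) atTop (𝓝 1) := by
    simpa using (tendsto_natCast_div_add_atTop (γ.2 : ℝ)).pow d
  have hprod := hlim.mul hratio
  rw [mul_one] at hprod
  suffices h : ∀ᶠ m : ℕ in atTop,
      a < ((sgSlice S (m + γ.2)).ncard : ℝ) / ((m + γ.2 : ℕ) : ℝ) ^ d by
    filter_upwards [(tendsto_sub_atTop_nat γ.2).eventually h, eventually_ge_atTop γ.2]
      with n hn hle
    rwa [Nat.sub_add_cancel hle] at hn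
  filter_upwards [hprod.eventually (lt_mem_nhds ha), eventually_ne_atTop 0] with m hm hm0
  have hm' : (0 : ℝ) < m := by positivity
  refine hm.trans_le ?_
  rw [div_pow, div_mul_div_cancel₀ (by positivity), Nat.cast_add]
  refine div_le_div_of_nonneg_right (Nat.cast_le.2 ?_) (by positivity)
  refine Set.ncard_le_ncard_of_injOn (· + γ.1) (fun x hx => ?_)
    (add_left_injective γ.1).injOn (finite_sgSlice hA (by omega))
  refine hγ (x, m) ?_
  have h := finCone_smul_mem (interior_subset hx : _ ∈ finSlice T) hm'.le
  convert h using 1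
  ext
  · simp [sgEmb, mul_div_cancel₀ _ hm'.ne']
  · simp [sgEmb]

end Body

/-- (Okounkov; Lazarsfeld–Mustaţă) If `S ⊆ ℤ^d × ℕ` (`d ≥ 1`) is a subsemigroup satisfying
conditions (A) and (B), then `lim_{n→∞} #S_n/n^d = vol(Δ(S))`. -/
theorem statement12 (d : ℕ) (hd : 1 ≤ d) (S : Set ((Fin d → ℤ) × ℕ))
    (hadd : ∀ x ∈ S, ∀ y ∈ S, x + y ∈ S)
    (hA : sgCondA S) (hB : sgCondB S) :
    Tendsto (fun n : ℕ => ((sgSlice S n).ncard : ℝ) / (n : ℝ) ^ d) atTop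
      (𝓝 (MeasureTheory.volume (sgBody S)).toReal) := by
  classical
  have hbdd := isBounded_sgBody hA
  have hlt : volume (sgBody S) ≠ ⊤ := hbdd.measure_lt_top.ne
  obtain ⟨T₀, hT₀, hspan₀⟩ := exists_finset_span_eq_top hB
  refine tendsto_order.2 ⟨fun a ha => ?_, fun a ha => ?_⟩
  · obtain ⟨T, hTS, hT₀T, haT⟩ : ∃ T : Finset ((Fin d → ℤ) × ℕ), ↑T ⊆ S ∧ T₀ ⊆ T ∧
        (a < 0 ∨ a < volume.real (finSlice T)) := by
      rcases lt_or_ge a 0 with h0 | h0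
      · exact ⟨T₀, hT₀, subset_rfl, Or.inl h0⟩
      rw [← ENNReal.ofReal_lt_iff_lt_toReal h0 hlt, volume_sgBody, lt_iSup_iff] at ha
      obtain ⟨T, hT⟩ := ha
      have hTU : ((T.1 ∪ T₀ : Finset _) : Set ((Fin d → ℤ) × ℕ)) ⊆ S := by
        simpa using ⟨T.2, hT₀⟩
      refine ⟨T.1 ∪ T₀, hTU, Finset.subset_union_right, Or.inr ?_⟩
      rw [Measure.real, ← ENNReal.ofReal_lt_iff_lt_toReal h0
        (measure_ne_top_of_subset (finSlice_subset_sgBody hTU) hlt)]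
      exact hT.trans_le (measure_mono (finSlice_mono Finset.subset_union_left))
    rcases haT with h0 | haT
    · exact Eventually.of_forall fun n => h0.trans_le (by positivity)
    · exact eventually_lt_ncard_sgSlice hadd hA hTS (top_unique (hspan₀ ▸
        Submodule.span_mono (Set.image_mono (Finset.coe_subset.2 hT₀T)))) haT
  · have hlim := tendsto_ncard_dilateLatticePoints hbdd (isClosed_sgBody S).measurableSet
      ((convex_sgBody S).addHaar_frontier volume)
    filter_upwards [hlim.eventually (gt_mem_nhds ha), eventually_ne_atTop 0] with n hn hn0
    refine lt_of_le_of_lt ?_ hn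
    refine div_le_div_of_nonneg_right (Nat.cast_le.2 ?_) (by positivity)
    exact Set.ncard_le_ncard (sgSlice_subset_dilateLatticePoints S hn0)
      (dilateLatticePoints_finite hbdd hn0)
end

section
/- Let d ≥ 1 and let S be a subsemigroup of ℤ^d × ℕ satisfying condition (A) and condition (B). Fix ε > 0. Then there is an integer p_0 = p_0(ε) such that for every p ≥ p_0, the limit lim_{k→∞} #(k*S_p)/(k^d·p^d) exists and is ≥ vol(Δ(S)) − ε, where k*S_p = {x_1 + ⋯ + x_k : x_1,…,x_k ∈ S_p} ⊆ ℤ^d. -/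
open Filter Topology

/-- `k*S_p = {x_1 + ⋯ + x_k : x_1,…,x_k ∈ S_p} ⊆ ℤ^d`. -/
def sgSumSet {d : ℕ} (S : Set ((Fin d → ℤ) × ℕ)) (k p : ℕ) : Set (Fin d → ℤ) :=
  {y | ∃ f : Fin k → (Fin d → ℤ), (∀ i, f i ∈ sgSlice S p) ∧ y = ∑ i, f i}

open scoped Pointwise

/-- The inclusion `ℤ^d → ℝ^d`. -/
def realVec (d : ℕ) : (Fin d → ℤ) →+ (Fin d → ℝ) := (Int.castAddHom ℝ).compLeft (Fin d)

@[simp] lemma realVec_apply {d : ℕ} (x : Fin d → ℤ) (i : Fin d) : realVec d x i = x i := rfl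

lemma realVec_injective (d : ℕ) : Function.Injective (realVec d) := fun x y h => by
  ext i
  simpa using congrFun h i

/-- The set of sums of `k` elements of `A`. -/
def iterSum {d : ℕ} (A : Set (Fin d → ℤ)) (k : ℕ) : Set (Fin d → ℤ) :=
  {y | ∃ f : Fin k → (Fin d → ℤ), (∀ i, f i ∈ A) ∧ y = ∑ i, f i}

lemma iterSum_finite {d : ℕ} {A : Set (Fin d → ℤ)} (hA : A.Finite) (k : ℕ) :
    (iterSum A k).Finite := by
  refine ((Set.Finite.pi' fun _ : Fin k => hA).image fun f => ∑ i, f i).subset ?_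
  rintro y ⟨f, hf, rfl⟩
  exact ⟨f, hf, rfl⟩

lemma add_mem_iterSum {d : ℕ} {A : Set (Fin d → ℤ)} {k l : ℕ} {x y : Fin d → ℤ}
    (hx : x ∈ iterSum A k) (hy : y ∈ iterSum A l) : x + y ∈ iterSum A (k + l) := by
  obtain ⟨f, hf, rfl⟩ := hx
  obtain ⟨g, hg, rfl⟩ := hy
  refine ⟨Fin.append f g, fun i => ?_, by simp [Fin.sum_univ_add]⟩
  refine Fin.addCases (fun i => ?_) (fun i => ?_) i
  · simpa using hf i
  · simpa using hg i

lemma sum_nsmul_mem_iterSum {d : ℕ} {A : Set (Fin d → ℤ)} (T : Finset (Fin d → ℤ))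
    (hT : ∀ a ∈ T, a ∈ A) (n : (Fin d → ℤ) → ℕ) :
    ∑ a ∈ T, n a • a ∈ iterSum A (∑ a ∈ T, n a) := by
  classical
  induction T using Finset.induction_on with
  | empty => exact ⟨0, fun i => i.elim0, (Finset.sum_empty).symm⟩
  | insert a T ha ih =>
    rw [Finset.sum_insert ha, Finset.sum_insert ha]
    refine add_mem_iterSum ⟨fun _ => a, fun _ => hT a (by simp), by simp⟩
      (ih fun b hb => hT b (by simp [hb]))

lemma realVec_mem_smul_convexHull {d : ℕ} {A : Set (Fin d → ℤ)} {k : ℕ} (hk : k ≠ 0)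
    {y : Fin d → ℤ} (hy : y ∈ iterSum A k) :
    realVec d y ∈ (k : ℝ) • convexHull ℝ (realVec d '' A) := by
  obtain ⟨f, hf, rfl⟩ := hy
  have hk' : (k : ℝ) ≠ 0 := by exact_mod_cast hk
  refine ⟨∑ i, (k : ℝ)⁻¹ • realVec d (f i), ?_, ?_⟩
  · refine (convex_convexHull ℝ _).sum_mem (fun _ _ => by positivity) (by simp [hk']) fun i _ => ?_
    exact subset_convexHull ℝ _ ⟨f i, hf i, rfl⟩
  · simp only [← Finset.smul_sum, map_sum]
    exact smul_inv_smul₀ hk' _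

lemma exists_weights_of_mem_smul_convexHull {d : ℕ} {A : Finset (Fin d → ℤ)} {k : ℕ}
    {y : Fin d → ℝ} (hy : y ∈ (k : ℝ) • convexHull ℝ (realVec d '' (A : Set (Fin d → ℤ)))) :
    ∃ c : (Fin d → ℤ) → ℝ, (∀ a ∈ A, 0 ≤ c a) ∧ ∑ a ∈ A, c a = k ∧
      ∀ i, ∑ a ∈ A, c a * a i = y i := by
  classical
  obtain ⟨z, hz, rfl⟩ := hy
  rw [← Finset.coe_image, Finset.mem_convexHull'] at hz
  obtain ⟨w, hw0, hw1, rfl⟩ := hz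
  rw [Finset.sum_image (realVec_injective d).injOn] at hw1 ⊢
  refine ⟨fun a => k * w (realVec d a), fun a ha => ?_, ?_, fun i => ?_⟩
  · exact mul_nonneg k.cast_nonneg (hw0 _ (Finset.mem_image_of_mem _ ha))
  · rw [← Finset.mul_sum, hw1, mul_one]
  · simp [Finset.mul_sum, mul_assoc]

/-- Up to a fixed translation, every lattice point of `k • conv A` is a sum of `k + M` elements of
`A`, as soon as the points `(a, 1)` generate `ℤ^d × ℤ`. -/
lemma exists_add_mem_iterSum {d : ℕ} (A : Finset (Fin d → ℤ))
    (hgen : ∀ (z : Fin d → ℤ) (t : ℤ), ∃ n : (Fin d → ℤ) → ℤ,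
      ∑ a ∈ A, n a • a = z ∧ ∑ a ∈ A, n a = t) :
    ∃ (M : ℕ) (w : Fin d → ℤ), ∀ (k : ℕ) (y : Fin d → ℤ),
      realVec d y ∈ (k : ℝ) • convexHull ℝ (realVec d '' (A : Set (Fin d → ℤ))) →
      y + w ∈ iterSum (A : Set (Fin d → ℤ)) (k + M) := by
  classical
  choose n hn1 hn2 using hgen
  set b : Fin d → ℤ := fun i => ∑ a ∈ A, |a i| with hb
  set F : Finset (Fin d → ℤ) := Finset.Icc (-b) b
  set G : Finset ℤ := Finset.Icc 0 (A.card : ℤ)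
  set N : ℕ := ∑ r ∈ F, ∑ t ∈ G, ∑ a ∈ A, (n r t a).natAbs
  have hNle : ∀ r ∈ F, ∀ t ∈ G, ∀ a ∈ A, (n r t a).natAbs ≤ N := fun r hr t ht a ha =>
    calc (n r t a).natAbs ≤ ∑ a ∈ A, (n r t a).natAbs :=
          Finset.single_le_sum (f := fun a => (n r t a).natAbs) (fun _ _ => Nat.zero_le _) ha
      _ ≤ ∑ t ∈ G, ∑ a ∈ A, (n r t a).natAbs :=
          Finset.single_le_sum (f := fun t => ∑ a ∈ A, (n r t a).natAbs)
            (fun _ _ => Nat.zero_le _) ht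
      _ ≤ N := Finset.single_le_sum (f := fun r => ∑ t ∈ G, ∑ a ∈ A, (n r t a).natAbs)
            (fun _ _ => Nat.zero_le _) hr
  refine ⟨N * A.card, N • ∑ a ∈ A, a, fun k y hy => ?_⟩
  obtain ⟨c, hc0, hc1, hc2⟩ := exists_weights_of_mem_smul_convexHull hy
  set r : Fin d → ℤ := y - ∑ a ∈ A, ⌊c a⌋ • a with hr
  set t : ℤ := k - ∑ a ∈ A, ⌊c a⌋ with ht
  have hri : ∀ i, (r i : ℝ) = ∑ a ∈ A, Int.fract (c a) * a i := fun i => by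
    have := hc2 i
    rw [realVec_apply] at this
    simp only [← Int.self_sub_floor, sub_mul, Finset.sum_sub_distrib, this]
    simp [hr]
  have hrF : r ∈ F := by
    have habs : ∀ i, |r i| ≤ b i := fun i => by
      have : |(r i : ℝ)| ≤ (b i : ℝ) := by
        rw [hri, hb]
        push_cast
        refine (Finset.abs_sum_le_sum_abs _ _).trans (Finset.sum_le_sum fun a _ => ?_)
        rw [abs_mul, abs_of_nonneg (Int.fract_nonneg _)]
        exact mul_le_of_le_one_left (abs_nonneg _) (Int.fract_lt_one _).le
      exact_mod_cast this
    exact Finset.mem_Icc.2 ⟨fun i => (abs_le.1 (habs i)).1, fun i => (abs_le.1 (habs i)).2⟩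
  have hti : (t : ℝ) = ∑ a ∈ A, Int.fract (c a) := by
    simp only [← Int.self_sub_floor, Finset.sum_sub_distrib, hc1]
    simp [ht]
  have htG : t ∈ G := by
    refine Finset.mem_Icc.2 ⟨?_, ?_⟩
    · have : (0 : ℝ) ≤ t := hti ▸ Finset.sum_nonneg fun a _ => Int.fract_nonneg _
      exact_mod_cast this
    · have : (t : ℝ) ≤ A.card := by
        rw [hti]
        exact (Finset.sum_le_card_nsmul A _ 1 fun a _ => (Int.fract_lt_one _).le).trans (by simp)
      exact_mod_cast this
  have hpos : ∀ a ∈ A, 0 ≤ ⌊c a⌋ + n r t a + N := fun a ha => by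
    have h1 := hNle r hrF t htG a ha
    have h2 : 0 ≤ ⌊c a⌋ := Int.floor_nonneg.2 (hc0 a ha)
    omega
  have key := sum_nsmul_mem_iterSum (A := (A : Set (Fin d → ℤ))) A (fun a ha => ha)
    fun a => (⌊c a⌋ + n r t a + N).toNat
  have hcount : ∑ a ∈ A, (⌊c a⌋ + n r t a + N).toNat = k + N * A.card := by
    zify
    rw [Finset.sum_congr rfl fun a ha => Int.toNat_of_nonneg (hpos a ha),
      Finset.sum_add_distrib, Finset.sum_add_distrib, hn2]
    simp [ht, mul_comm]
  have hvalue : ∑ a ∈ A, (⌊c a⌋ + n r t a + N).toNat • a = y + N • ∑ a ∈ A, a := by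
    have : ∀ a ∈ A, (⌊c a⌋ + n r t a + N).toNat • a = (⌊c a⌋ + n r t a + N) • a := fun a ha => by
      rw [← natCast_zsmul, Int.toNat_of_nonneg (hpos a ha)]
    rw [Finset.sum_congr rfl this]
    simp only [add_smul, Finset.sum_add_distrib, hn1, natCast_zsmul]
    rw [hr, add_sub_cancel, Finset.smul_sum]
  rwa [hcount, hvalue] at key

lemma ncard_lattice_eq {d : ℕ} (K : Set (Fin d → ℝ)) {k : ℕ} (hk : k ≠ 0) :
    Nat.card ↑(K ∩ (k : ℝ)⁻¹ •
      (Submodule.span ℤ (Set.range (Pi.basisFun ℝ (Fin d))) : Set (Fin d → ℝ))) =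
      {y : Fin d → ℤ | realVec d y ∈ (k : ℝ) • K}.ncard := by
  have hk' : (k : ℝ) ≠ 0 := by exact_mod_cast hk
  have hinj : Function.Injective fun y => (k : ℝ)⁻¹ • realVec d y :=
    (smul_right_injective _ (inv_ne_zero hk')).comp (realVec_injective d)
  rw [← Set.ncard_image_of_injective _ hinj, ← Nat.card_coe_set_eq]
  congr 2
  ext x
  constructor
  · rintro ⟨hxK, z, hz, rfl⟩
    rw [SetLike.mem_coe, Module.Basis.mem_span_iff_repr_mem] at hz
    choose y hy using hz
    have hyz : realVec d y = z := by
      ext i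
      simpa using hy i
    refine ⟨y, ?_, by simp only [hyz]⟩
    exact (Set.mem_smul_set_iff_inv_smul_mem₀ hk' K _).2 (by simpa only [hyz] using hxK)
  · rintro ⟨y, hy, rfl⟩
    refine ⟨(Set.mem_smul_set_iff_inv_smul_mem₀ hk' K _).1 hy, realVec d y, ?_, rfl⟩
    rw [SetLike.mem_coe, Module.Basis.mem_span_iff_repr_mem]
    exact fun i => ⟨y i, by simp⟩

/-- If the points `(a, 1)`, `a ∈ A`, generate `ℤ^d × ℤ`, then `#(k*A) / k^d` tends to the volume
of the convex hull of `A`. -/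
theorem tendsto_ncard_iterSum_div_pow {d : ℕ} (A : Finset (Fin d → ℤ))
    (hgen : ∀ (z : Fin d → ℤ) (t : ℤ), ∃ n : (Fin d → ℤ) → ℤ,
      ∑ a ∈ A, n a • a = z ∧ ∑ a ∈ A, n a = t) :
    Tendsto (fun k : ℕ => ((iterSum (A : Set (Fin d → ℤ)) k).ncard : ℝ) / (k : ℝ) ^ d) atTop
      (𝓝 (MeasureTheory.volume.real (convexHull ℝ (realVec d '' (A : Set (Fin d → ℤ)))))) := by
  set K := convexHull ℝ (realVec d '' (A : Set (Fin d → ℤ)))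
  have hK : IsCompact K := (A.finite_toSet.image _).isCompact_convexHull ℝ
  have hE := tendsto_card_div_pow_atTop_volume K hK.isBounded hK.measurableSet
    ((convex_convexHull ℝ _).addHaar_frontier _)
  rw [Fintype.card_fin] at hE
  obtain ⟨M, w, hw⟩ := exists_add_mem_iterSum A hgen
  set E : ℕ → Set (Fin d → ℤ) := fun k => {y | realVec d y ∈ (k : ℝ) • K}
  replace hE : Tendsto (fun k : ℕ => ((E k).ncard : ℝ) / (k : ℝ) ^ d) atTop
      (𝓝 (MeasureTheory.volume.real K)) := by
    refine hE.congr' ?_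
    filter_upwards [eventually_ne_atTop 0] with k hk
    rw [ncard_lattice_eq K hk]
  have hmaps : ∀ k, Set.MapsTo (· + w) (E k) (iterSum (A : Set (Fin d → ℤ)) (k + M)) :=
    fun k y hy => hw k y hy
  have hfin : ∀ k, (iterSum (A : Set (Fin d → ℤ)) k).Finite := iterSum_finite A.finite_toSet
  have hEfin : ∀ k, (E k).Finite := fun k =>
    Set.Finite.of_injOn (hmaps k) (add_left_injective w).injOn (hfin _)
  have hupper : ∀ k, k ≠ 0 → (iterSum (A : Set (Fin d → ℤ)) k).ncard ≤ (E k).ncard :=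
    fun k hk => Set.ncard_le_ncard (fun y hy => realVec_mem_smul_convexHull hk hy) (hEfin k)
  have hlower : ∀ k, (E k).ncard ≤ (iterSum (A : Set (Fin d → ℤ)) (k + M)).ncard := fun k =>
    Set.ncard_le_ncard_of_injOn _ (hmaps k) (add_left_injective w).injOn (hfin _)
  rw [← tendsto_add_atTop_iff_nat M]
  have hratio : Tendsto (fun k : ℕ => ((k : ℝ) / (k + M)) ^ d) atTop (𝓝 1) := by
    simpa using (tendsto_natCast_div_add_atTop (M : ℝ)).pow d
  have hlow := hE.mul hratio
  rw [mul_one] at hlow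
  refine tendsto_of_tendsto_of_tendsto_of_le_of_le' hlow
    ((tendsto_add_atTop_iff_nat M).2 hE) ?_ ?_
  · filter_upwards [eventually_ne_atTop 0] with k hk
    have hk' : (k : ℝ) ≠ 0 := by exact_mod_cast hk
    rw [div_pow, div_mul_div_cancel₀ (pow_ne_zero _ hk')]
    push_cast
    exact div_le_div_of_nonneg_right (by exact_mod_cast hlower k) (by positivity)
  · filter_upwards [eventually_ne_atTop 0] with k hk
    exact div_le_div_of_nonneg_right (by exact_mod_cast hupper _ (by omega)) (by positivity)

section Semigroup

variable {d : ℕ} {S : Set ((Fin d → ℤ) × ℕ)}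

lemma one_le_degree_of_sgCondA (hA : sgCondA S) {s : (Fin d → ℤ) × ℕ} (hs : s ∈ S) : 1 ≤ s.2 := by
  obtain ⟨r, v, hv⟩ := hA
  replace hs := hv hs
  induction hs using AddSubsemigroup.closure_induction with
  | mem x hx =>
    obtain ⟨j, rfl⟩ := hx
    exact le_rfl
  | add x y _ _ hx hy => exact hx.trans (Nat.le_add_right _ _)

lemma sgSlice_finite_of_sgCondA (hA : sgCondA S) (p : ℕ) : (sgSlice S p).Finite := by
  obtain ⟨r, v, hv⟩ := hA
  set b : Fin d → ℤ := fun i => ∑ j, (v j i : ℤ) with hb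
  have key : ∀ s ∈ S, 0 ≤ s.1 ∧ s.1 ≤ s.2 • b := fun s hs => by
    replace hs := hv hs
    induction hs using AddSubsemigroup.closure_induction with
    | mem x hx =>
      obtain ⟨j, rfl⟩ := hx
      refine ⟨fun i => Int.natCast_nonneg _, fun i => ?_⟩
      simpa [hb] using Finset.single_le_sum (f := fun j => (v j i : ℤ))
        (fun _ _ => Int.natCast_nonneg _) (Finset.mem_univ j)
    | add x y _ _ hx hy =>
      refine ⟨add_nonneg hx.1 hy.1, ?_⟩
      rw [Prod.fst_add, Prod.snd_add, add_smul]
      exact add_le_add hx.2 hy.2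
  exact (Set.finite_Icc (0 : Fin d → ℤ) (p • b)).subset fun x hx => key _ hx

lemma add_nsmul_mem (hadd : ∀ x ∈ S, ∀ y ∈ S, x + y ∈ S) {x y : (Fin d → ℤ) × ℕ} (hx : x ∈ S)
    (hy : y ∈ S) (n : ℕ) : x + n • y ∈ S := by
  induction n with
  | zero => simpa using hx
  | succ n ih =>
    rw [succ_nsmul, ← add_assoc]
    exact hadd _ ih _ hy

lemma nsmul_mem_of_pos (hadd : ∀ x ∈ S, ∀ y ∈ S, x + y ∈ S) {x : (Fin d → ℤ) × ℕ} (hx : x ∈ S)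
    {n : ℕ} (hn : 0 < n) : n • x ∈ S := by
  obtain ⟨m, rfl⟩ := Nat.exists_eq_add_of_lt hn
  simpa [add_smul, add_comm] using add_nsmul_mem hadd hx hx m

lemma exists_sub_of_sgCondB (hadd : ∀ x ∈ S, ∀ y ∈ S, x + y ∈ S) (hB : sgCondB S)
    (z : (Fin d → ℤ) × ℤ) :
    ∃ s ∈ S, ∃ t ∈ S, z.1 = s.1 - t.1 ∧ z.2 = (s.2 : ℤ) - t.2 := by
  have hne : S.Nonempty := by
    rw [Set.nonempty_iff_ne_empty]
    rintro rfl
    have h : ((0, 1) : (Fin d → ℤ) × ℤ) ∈ (⊤ : AddSubgroup _) := trivial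
    rw [← hB] at h
    simp at h
  have hz : z ∈ (⊤ : AddSubgroup ((Fin d → ℤ) × ℤ)) := trivial
  rw [← hB] at hz
  induction hz using AddSubgroup.closure_induction with
  | mem x hx =>
    obtain ⟨s, hs, rfl⟩ := hx
    exact ⟨s + s, hadd _ hs _ hs, s, hs, by simp, by simp⟩
  | zero =>
    obtain ⟨s, hs⟩ := hne
    exact ⟨s, hs, s, hs, by simp, by simp⟩
  | add x y _ _ hx hy =>
    obtain ⟨s, hs, t, ht, h1, h2⟩ := hx
    obtain ⟨s', hs', t', ht', h1', h2'⟩ := hy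
    refine ⟨s + s', hadd _ hs _ hs', t + t', hadd _ ht _ ht', ?_, ?_⟩
    · rw [Prod.fst_add, h1, h1', Prod.fst_add, Prod.fst_add]
      abel
    · rw [Prod.snd_add, h2, h2', Prod.snd_add, Prod.snd_add]
      push_cast
      ring
  | neg x _ hx =>
    obtain ⟨s, hs, t, ht, h1, h2⟩ := hx
    exact ⟨t, ht, s, hs, by simp [h1], by simp [h2]⟩

lemma exists_forall_sgSlice_nonempty (hadd : ∀ x ∈ S, ∀ y ∈ S, x + y ∈ S) (hA : sgCondA S)
    (hB : sgCondB S) : ∃ m, ∀ p, m ≤ p → (sgSlice S p).Nonempty := by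
  obtain ⟨s, hs, t, ht, -, h⟩ := exists_sub_of_sgCondB hadd hB (0, 1)
  have ht1 := one_le_degree_of_sgCondA hA ht
  have hst : s.2 = t.2 + 1 := by
    simp only at h
    omega
  refine ⟨t.2 * t.2, fun p hp => ?_⟩
  have hq : t.2 ≤ p / t.2 := (Nat.le_div_iff_mul_le ht1).2 hp
  have hr : p % t.2 < t.2 := Nat.mod_lt _ ht1
  have hmem := add_nsmul_mem hadd (nsmul_mem_of_pos hadd ht (n := p / t.2 - p % t.2) (by omega)) hs
    (p % t.2)
  have hdeg : ((p / t.2 - p % t.2) • t + (p % t.2) • s).2 = p := by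
    obtain ⟨c, hc⟩ := Nat.exists_eq_add_of_le (hr.le.trans hq)
    have hp' := Nat.div_add_mod p t.2
    simp only [Prod.snd_add, Prod.smul_snd, smul_eq_mul, hst]
    rw [hc, Nat.add_sub_cancel_left]
    rw [hc] at hp'
    linarith
  refine ⟨((p / t.2 - p % t.2) • t + (p % t.2) • s).1, ?_⟩
  rwa [← Prod.mk.eta (p := _ + _), hdeg] at hmem

/-- In all large degrees `p` the points `(a, 1)`, `a ∈ S_p`, generate `ℤ^d × ℤ`. -/
lemma exists_forall_sgSlice_generates (hadd : ∀ x ∈ S, ∀ y ∈ S, x + y ∈ S) (hA : sgCondA S)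
    (hB : sgCondB S) :
    ∃ m, ∀ p, m ≤ p → ∀ A : Finset (Fin d → ℤ), (A : Set (Fin d → ℤ)) = sgSlice S p →
      ∀ (z : Fin d → ℤ) (t : ℤ), ∃ n : (Fin d → ℤ) → ℤ,
        ∑ a ∈ A, n a • a = z ∧ ∑ a ∈ A, n a = t := by
  classical
  obtain ⟨m, hm⟩ := exists_forall_sgSlice_nonempty hadd hA hB
  choose s hs t ht h1 h2 using fun i : Fin d =>
    exists_sub_of_sgCondB hadd hB (Pi.single i 1, 0)
  refine ⟨m + ∑ i, (s i).2, fun p hp A hAp z c => ?_⟩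
  have hmemA : ∀ a, a ∈ A ↔ (a, p) ∈ S := fun a => by
    rw [← Finset.mem_coe, hAp]
    rfl
  set P : Submodule ℤ ((Fin d → ℤ) × ℤ) :=
    Submodule.span ℤ (A.image fun a => ((a, 1) : (Fin d → ℤ) × ℤ))
  have hA1 : ∀ a ∈ A, ((a, 1) : (Fin d → ℤ) × ℤ) ∈ P := fun a ha =>
    Submodule.subset_span (Finset.mem_coe.2 (Finset.mem_image_of_mem _ ha))
  have hbasis : ∀ i, ((Pi.single i 1, 0) : (Fin d → ℤ) × ℤ) ∈ P := fun i => by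
    have hle : (s i).2 ≤ ∑ i, (s i).2 :=
      Finset.single_le_sum (f := fun i => (s i).2) (fun _ _ => Nat.zero_le _) (Finset.mem_univ i)
    obtain ⟨u, hu⟩ := hm (p - (s i).2) (by omega)
    have hdeg : (s i).2 = (t i).2 := by
      have := h2 i
      simp only at this
      omega
    have hsu : (s i).1 + u ∈ A := by
      rw [hmemA]
      convert hadd _ (hs i) _ hu using 1
      exact Prod.ext rfl (show p = _ + _ by omega)
    have htu : (t i).1 + u ∈ A := by
      rw [hmemA]
      convert hadd _ (ht i) _ hu using 1
      exact Prod.ext rfl (show p = _ + _ by omega)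
    convert P.sub_mem (hA1 _ hsu) (hA1 _ htu) using 1
    refine Prod.ext ?_ (by simp)
    simpa using h1 i
  have hfst : ∀ z : Fin d → ℤ, ((z, 0) : (Fin d → ℤ) × ℤ) ∈ P := fun z => by
    have : ((z, 0) : (Fin d → ℤ) × ℤ) = ∑ i, z i • (Pi.single i 1, 0) := by
      refine Prod.ext ?_ (by simp [Prod.snd_sum])
      rw [Prod.fst_sum]
      ext j
      simp [Finset.sum_apply, Pi.single_apply]
    rw [this]
    exact P.sum_mem fun i _ => P.smul_mem _ (hbasis i)
  have hsnd : ((0, 1) : (Fin d → ℤ) × ℤ) ∈ P := by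
    obtain ⟨u, hu⟩ := hm p (by omega)
    simpa using P.sub_mem (hA1 u ((hmemA u).2 hu)) (hfst u)
  have hzc : ((z, c) : (Fin d → ℤ) × ℤ) ∈ P := by
    simpa using P.add_mem (hfst z) (P.smul_mem c hsnd)
  obtain ⟨f, -, hf⟩ := Submodule.mem_span_finset.1 hzc
  rw [Finset.sum_image fun a _ b _ hab => congrArg Prod.fst hab] at hf
  refine ⟨fun a => f (a, 1), ?_, ?_⟩
  · simpa [Prod.fst_sum] using congrArg Prod.fst hf
  · simpa [Prod.snd_sum] using congrArg Prod.snd hf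

/-- The convex hull of `S_p`, scaled by `1 / p`. -/
noncomputable def scaledHull (S : Set ((Fin d → ℤ) × ℕ)) (p : ℕ) : Set (Fin d → ℝ) :=
  (p : ℝ)⁻¹ • convexHull ℝ (realVec d '' sgSlice S p)

lemma convex_scaledHull (p : ℕ) : Convex ℝ (scaledHull S p) :=
  (convex_convexHull ℝ _).smul _

lemma isCompact_scaledHull (hA : sgCondA S) (p : ℕ) : IsCompact (scaledHull S p) :=
  (((sgSlice_finite_of_sgCondA hA p).image _).isCompact_convexHull ℝ).smul _

lemma inv_smul_realVec_mem_scaledHull {s : (Fin d → ℤ) × ℕ} (hs : s ∈ S) :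
    (s.2 : ℝ)⁻¹ • realVec d s.1 ∈ scaledHull S s.2 :=
  Set.smul_mem_smul_set (subset_convexHull ℝ _ ⟨s.1, hs, rfl⟩)

lemma scaledHull_subset_mul (hadd : ∀ x ∈ S, ∀ y ∈ S, x + y ∈ S) (p : ℕ) {m : ℕ} (hm : 0 < m) :
    scaledHull S p ⊆ scaledHull S (m * p) := by
  have hm' : (m : ℝ) ≠ 0 := by exact_mod_cast hm.ne'
  have hsub : (m : ℝ) • realVec d '' sgSlice S p ⊆ realVec d '' sgSlice S (m * p) := by
    rintro _ ⟨_, ⟨v, hv, rfl⟩, rfl⟩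
    exact ⟨m • v, nsmul_mem_of_pos hadd hv hm, by rw [map_nsmul, ← Nat.cast_smul_eq_nsmul ℝ]⟩
  calc scaledHull S p
      = ((m * p : ℕ) : ℝ)⁻¹ • ((m : ℝ) • convexHull ℝ (realVec d '' sgSlice S p)) := by
        rw [smul_smul, scaledHull]
        push_cast
        rw [mul_inv, mul_right_comm, inv_mul_cancel₀ hm', one_mul]
    _ ⊆ scaledHull S (m * p) := by
        rw [← convexHull_smul]
        exact Set.smul_set_mono (convexHull_mono hsub)

lemma scaledHull_subset_of_dvd (hadd : ∀ x ∈ S, ∀ y ∈ S, x + y ∈ S) {p q : ℕ} (hq : 0 < q)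
    (hpq : p ∣ q) : scaledHull S p ⊆ scaledHull S q := by
  obtain ⟨m, rfl⟩ := hpq
  rw [mul_comm]
  exact scaledHull_subset_mul hadd p (Nat.pos_of_mul_pos_left hq)

lemma monotone_scaledHull_factorial (hadd : ∀ x ∈ S, ∀ y ∈ S, x + y ∈ S) :
    Monotone fun n : ℕ => scaledHull S n.factorial := fun _ _ hab =>
  scaledHull_subset_of_dvd hadd (Nat.factorial_pos _) (Nat.factorial_dvd_factorial hab)

lemma inv_smul_mem_iUnion_scaledHull (hadd : ∀ x ∈ S, ∀ y ∈ S, x + y ∈ S) (hA : sgCondA S)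
    {m : ℕ} {c : Fin m → ℝ} {v : Fin m → ((Fin d → ℤ) × ℕ)} (hc : ∀ i, 0 ≤ c i)
    (hv : ∀ i, v i ∈ S) (hpos : 0 < (∑ i, c i • sgEmb (v i)).2) :
    (∑ i, c i • sgEmb (v i)).2⁻¹ • (∑ i, c i • sgEmb (v i)).1 ∈
      ⋃ n : ℕ, scaledHull S n.factorial := by
  set τ := (∑ i, c i • sgEmb (v i)).2 with hτ
  have hτsum : τ = ∑ i, c i * (v i).2 := by simp [hτ, Prod.snd_sum, sgEmb]
  set N := ∑ i, (v i).2
  have hmem : ∀ i, ((v i).2 : ℝ)⁻¹ • realVec d (v i).1 ∈ scaledHull S N.factorial := fun i =>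
    scaledHull_subset_of_dvd hadd (Nat.factorial_pos _)
      (Nat.dvd_factorial (one_le_degree_of_sgCondA hA (hv i))
        (Finset.single_le_sum (f := fun i => (v i).2) (fun _ _ => Nat.zero_le _)
          (Finset.mem_univ i)))
      (inv_smul_realVec_mem_scaledHull (hv i))
  refine Set.mem_iUnion.2 ⟨N, ?_⟩
  have hcomb := (convex_scaledHull (S := S) N.factorial).sum_mem (t := Finset.univ)
    (w := fun i => τ⁻¹ * (c i * (v i).2)) (fun i _ => by have := hc i; positivity)
    (by rw [← Finset.mul_sum, ← hτsum, inv_mul_cancel₀ hpos.ne']) (fun i _ => hmem i)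
  convert hcomb using 1
  rw [Prod.fst_sum, Finset.smul_sum]
  refine Finset.sum_congr rfl fun i _ => ?_
  have hi : ((v i).2 : ℝ) ≠ 0 := by
    have := one_le_degree_of_sgCondA hA (hv i)
    positivity
  rw [smul_smul, mul_assoc, mul_assoc, mul_inv_cancel₀ hi, mul_one, mul_smul]
  rfl

lemma sgBody_subset_closure (hadd : ∀ x ∈ S, ∀ y ∈ S, x + y ∈ S) (hA : sgCondA S) :
    sgBody S ⊆ closure (⋃ n : ℕ, scaledHull S n.factorial) := by
  intro x hx
  have hfreq := mem_closure_iff_frequently.1 (show (x, (1 : ℝ)) ∈ closure _ from hx)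
  have hpos : ∀ᶠ z : (Fin d → ℝ) × ℝ in 𝓝 (x, 1), 0 < z.2 :=
    continuousAt_snd.eventually (lt_mem_nhds one_pos)
  have htend : Tendsto (fun z : (Fin d → ℝ) × ℝ => z.2⁻¹ • z.1) (𝓝 (x, 1)) (𝓝 x) := by
    have : ContinuousAt (fun z : (Fin d → ℝ) × ℝ => z.2⁻¹ • z.1) (x, 1) :=
      (continuousAt_snd.inv₀ one_ne_zero).smul continuousAt_fst
    simpa [ContinuousAt] using this
  refine mem_closure_iff_frequently.2 (htend.frequently ((hfreq.and_eventually hpos).mono ?_))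
  rintro _ ⟨⟨m, c, v, hc, hv, rfl⟩, hz⟩
  exact inv_smul_mem_iUnion_scaledHull hadd hA hc hv hz

lemma volume_sgBody_le (hadd : ∀ x ∈ S, ∀ y ∈ S, x + y ∈ S) (hA : sgCondA S) :
    MeasureTheory.volume (sgBody S) ≤
      ⨆ n : ℕ, MeasureTheory.volume (scaledHull S n.factorial) := by
  have hmono := monotone_scaledHull_factorial hadd
  have hconv : Convex ℝ (⋃ n : ℕ, scaledHull S n.factorial) :=
    hmono.directed_le.convex_iUnion fun n => convex_scaledHull _
  calc MeasureTheory.volume (sgBody S)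
      ≤ MeasureTheory.volume (closure (⋃ n : ℕ, scaledHull S n.factorial)) :=
        MeasureTheory.measure_mono (sgBody_subset_closure hadd hA)
    _ = MeasureTheory.volume (⋃ n : ℕ, scaledHull S n.factorial) :=
        measure_closure_of_null_frontier (hconv.addHaar_frontier _)
    _ = _ := hmono.measure_iUnion

lemma exists_volume_scaledHull_ge (hadd : ∀ x ∈ S, ∀ y ∈ S, x + y ∈ S) (hA : sgCondA S)
    {δ : ℝ} (hδ : 0 < δ) :
    ∃ q, 0 < q ∧ (MeasureTheory.volume (sgBody S)).toReal - δ ≤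
      MeasureTheory.volume.real (scaledHull S q) := by
  by_cases hle : (MeasureTheory.volume (sgBody S)).toReal ≤ δ
  · exact ⟨1, one_pos, (sub_nonpos.2 hle).trans MeasureTheory.measureReal_nonneg⟩
  have htop : MeasureTheory.volume (sgBody S) ≠ ⊤ := fun h => hle (by simpa [h] using hδ.le)
  have hlt : ENNReal.ofReal ((MeasureTheory.volume (sgBody S)).toReal - δ) <
      MeasureTheory.volume (sgBody S) := by
    rw [ENNReal.ofReal_lt_iff_lt_toReal (by linarith) htop]
    linarith
  obtain ⟨n, hn⟩ := lt_iSup_iff.1 (hlt.trans_le (volume_sgBody_le hadd hA))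
  refine ⟨n.factorial, n.factorial_pos, ?_⟩
  exact (ENNReal.ofReal_le_iff_le_toReal (isCompact_scaledHull hA _).measure_lt_top.ne).1 hn.le

lemma measureReal_smul_nonneg (s : Set (Fin d → ℝ)) {r : ℝ} (hr : 0 ≤ r) :
    MeasureTheory.volume.real (r • s) = r ^ d * MeasureTheory.volume.real s := by
  rw [MeasureTheory.measureReal_def, MeasureTheory.Measure.addHaar_smul_of_nonneg _ hr,
    ENNReal.toReal_mul, ENNReal.toReal_ofReal (by positivity), Module.finrank_fin_fun,
    MeasureTheory.measureReal_def]

lemma measureReal_scaledHull (p : ℕ) :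
    MeasureTheory.volume.real (scaledHull S p) =
      MeasureTheory.volume.real (convexHull ℝ (realVec d '' sgSlice S p)) / (p : ℝ) ^ d := by
  rw [scaledHull, measureReal_smul_nonneg _ (by positivity), inv_pow, inv_mul_eq_div]

lemma measureReal_convexHull_mul_add (hadd : ∀ x ∈ S, ∀ y ∈ S, x + y ∈ S) (hA : sgCondA S)
    (q : ℕ) {m r : ℕ} (hm : 0 < m) (hr : (sgSlice S r).Nonempty) :
    (m : ℝ) ^ d * MeasureTheory.volume.real (convexHull ℝ (realVec d '' sgSlice S q)) ≤
      MeasureTheory.volume.real (convexHull ℝ (realVec d '' sgSlice S (m * q + r))) := by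
  obtain ⟨u, hu⟩ := hr
  have hsub : realVec d u +ᵥ ((m : ℝ) • (realVec d '' sgSlice S q)) ⊆
      realVec d '' sgSlice S (m * q + r) := by
    rintro _ ⟨_, ⟨_, ⟨v, hv, rfl⟩, rfl⟩, rfl⟩
    exact ⟨m • v + u, hadd _ (nsmul_mem_of_pos hadd hv hm) _ hu,
      by simp only [map_add, map_nsmul, ← Nat.cast_smul_eq_nsmul ℝ, vadd_eq_add, add_comm]⟩
  rw [← measureReal_smul_nonneg _ m.cast_nonneg, ← convexHull_smul,
    MeasureTheory.measureReal_def,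
    ← MeasureTheory.measure_vadd MeasureTheory.volume (realVec d u),
    ← convexHull_vadd, ← MeasureTheory.measureReal_def]
  exact MeasureTheory.measureReal_mono (convexHull_mono hsub)
    (((sgSlice_finite_of_sgCondA hA _).image _).isCompact_convexHull ℝ).measure_lt_top.ne

/-- The volumes of the scaled convex hulls of the `S_p` are eventually at least any given
`vol (conv S_q / q) - δ`. -/
lemma eventually_measureReal_scaledHull_ge (hadd : ∀ x ∈ S, ∀ y ∈ S, x + y ∈ S) (hA : sgCondA S)
    (hB : sgCondB S) {q : ℕ} (hq : 0 < q) {δ : ℝ} (hδ : 0 < δ) :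
    ∀ᶠ p in atTop, MeasureTheory.volume.real (scaledHull S q) - δ ≤
      MeasureTheory.volume.real (scaledHull S p) := by
  obtain ⟨n, hn⟩ := exists_forall_sgSlice_nonempty hadd hA hB
  set V := MeasureTheory.volume.real (scaledHull S q) with hV
  have hlim : Tendsto (fun p : ℕ => ((1 : ℝ) - ((n + q : ℕ) : ℝ) / p) ^ d * V) atTop (𝓝 V) := by
    simpa using (((tendsto_const_div_atTop_nhds_zero_nat ((n + q : ℕ) : ℝ)).const_sub 1).pow
      d).mul_const V
  filter_upwards [hlim.eventually (lt_mem_nhds (sub_lt_self V hδ)), eventually_ge_atTop (n + q)]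
    with p hp hpn
  refine hp.le.trans ?_
  set m := (p - n) / q with hm
  have hm0 : 0 < m := Nat.div_pos (by omega) hq
  have hdm := Nat.div_add_mod (p - n) q
  have hmod := Nat.mod_lt (p - n) hq
  rw [← hm, mul_comm] at hdm
  have hle := measureReal_convexHull_mul_add hadd hA q hm0 (hn (n + (p - n) % q) (by omega))
  rw [show m * q + (n + (p - n) % q) = p by omega] at hle
  have hp0 : (0 : ℝ) < p := by
    have : 0 < p := by omega
    exact_mod_cast this
  have hq0 : (0 : ℝ) < q := by exact_mod_cast hq
  have hmq : (p : ℝ) - (n + q : ℕ) ≤ m * q := by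
    have : p ≤ m * q + (n + q) := by omega
    have : (p : ℝ) ≤ m * q + (n + q : ℕ) := by exact_mod_cast this
    linarith
  have hpn' : ((n + q : ℕ) : ℝ) ≤ p := by exact_mod_cast hpn
  calc ((1 : ℝ) - ((n + q : ℕ) : ℝ) / p) ^ d * V
      ≤ ((m * q : ℝ) / p) ^ d * V := by
        refine mul_le_mul_of_nonneg_right (pow_le_pow_left₀ ?_ ?_ d)
          MeasureTheory.measureReal_nonneg
        · rw [sub_nonneg, div_le_one hp0]
          exact hpn'
        · rw [← div_self hp0.ne', ← sub_div]
          exact div_le_div_of_nonneg_right hmq hp0.le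
    _ = (m : ℝ) ^ d * MeasureTheory.volume.real (convexHull ℝ (realVec d '' sgSlice S q)) /
          (p : ℝ) ^ d := by
        rw [hV, measureReal_scaledHull, div_pow, mul_pow]
        field_simp
    _ ≤ MeasureTheory.volume.real (scaledHull S p) := by
        rw [measureReal_scaledHull]
        exact div_le_div_of_nonneg_right hle (by positivity)

end Semigroup

/-- (Lazarsfeld–Mustaţă) Let `S ⊆ ℤ^d × ℕ` (`d ≥ 1`) be a subsemigroup satisfying conditions
(A) and (B) and fix `ε > 0`.  Then there is `p₀ = p₀(ε)` such that for every `p ≥ p₀` the limit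
`lim_{k→∞} #(k*S_p)/(k^d p^d)` exists and is `≥ vol(Δ(S)) − ε`. -/
theorem statement13 (d : ℕ) (hd : 1 ≤ d) (S : Set ((Fin d → ℤ) × ℕ))
    (hadd : ∀ x ∈ S, ∀ y ∈ S, x + y ∈ S)
    (hA : sgCondA S) (hB : sgCondB S) (ε : ℝ) (hε : 0 < ε) :
    ∃ p₀ : ℕ, ∀ p : ℕ, p₀ ≤ p →
      ∃ L : ℝ,
        Tendsto (fun k : ℕ => ((sgSumSet S k p).ncard : ℝ) / ((k : ℝ) ^ d * (p : ℝ) ^ d))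
          atTop (𝓝 L) ∧
        (MeasureTheory.volume (sgBody S)).toReal - ε ≤ L := by
  obtain ⟨m, hm⟩ := exists_forall_sgSlice_generates hadd hA hB
  obtain ⟨q, hq, hqV⟩ := exists_volume_scaledHull_ge hadd hA (half_pos hε)
  obtain ⟨n, hn⟩ :=
    eventually_atTop.1 (eventually_measureReal_scaledHull_ge hadd hA hB hq (half_pos hε))
  refine ⟨max m n, fun p hp => ⟨MeasureTheory.volume.real (scaledHull S p), ?_, ?_⟩⟩
  · set A := (sgSlice_finite_of_sgCondA hA p).toFinset
    have hAp : (A : Set (Fin d → ℤ)) = sgSlice S p := Set.Finite.coe_toFinset _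
    have hlim := (tendsto_ncard_iterSum_div_pow A
      (hm p ((le_max_left _ _).trans hp) A hAp)).div_const ((p : ℝ) ^ d)
    rw [hAp, ← measureReal_scaledHull] at hlim
    simp only [div_div] at hlim
    exact hlim
  · linarith [hn p ((le_max_right _ _).trans hp)]
end

section
/- Let F be a field, ν a valuation on F with valuation ring V_ν dominating a local subring R (m_ν ∩ R = m_R), k = R/m_R, and let {I_n} be a graded family of ideals in R. Suppose t ≥ 1, f ∈ I_i and g ∈ I_j are nonzero elements, and dim_k (I_i ∩ K_{ν(f)})/(I_i ∩ K_{ν(f)}^+) ≥ t. Then dim_k (I_{i+j} ∩ K_{ν(fg)})/(I_{i+j} ∩ K_{ν(fg)}^+) ≥ t. -/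
open IsLocalRing

/-- Let `F` be a field, `ν` a valuation on `F` (written multiplicatively, so the
valuation-theoretic inequality `ν(x) ≥ γ` of the additive convention reads `ν x ≤ γ` here),
whose valuation ring `V_ν = {x : ν x ≤ 1}` dominates a local subring `R` of `F`, with residue
field `k = R/m_R`, and let `{I_n}` be a graded family of ideals in `R`.  Suppose `t ≥ 1`,
`f ∈ I_i`, `g ∈ I_j` are nonzero, and `dim_k (I_i ∩ K_{ν f})/(I_i ∩ K_{ν f}⁺) ≥ t`, expressed
by the existence of `u_1, …, u_t ∈ I_i ∩ K_{ν f}` whose classes are `k`-linearly independent: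
any `R`-linear combination lying in `K_{ν f}⁺` has all coefficients in `m_R`.  Then
`dim_k (I_{i+j} ∩ K_{ν (fg)})/(I_{i+j} ∩ K_{ν (fg)}⁺) ≥ t`. -/
theorem statement14 {F : Type*} [Field F] {Γ : Type*} [LinearOrderedCommGroupWithZero Γ]
    (ν : Valuation F Γ) (R : Subring F) [IsLocalRing R]
    (hRV : ∀ x ∈ R, ν x ≤ 1)
    (hdom : ∀ x : R, x ∈ maximalIdeal R ↔ ν (x : F) < 1)
    (I : ℕ → Ideal R) (hI0 : I 0 = ⊤) (hImul : ∀ i j, I i * I j ≤ I (i + j))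
    (t : ℕ) (ht : 1 ≤ t) (i j : ℕ) (f g : R)
    (hf0 : (f : F) ≠ 0) (hg0 : (g : F) ≠ 0) (hfI : f ∈ I i) (hgI : g ∈ I j)
    (hind : ∃ u : Fin t → R,
      (∀ l, u l ∈ I i) ∧ (∀ l, ν (u l : F) ≤ ν (f : F)) ∧
      ∀ a : Fin t → R, ν (∑ l, (a l : F) * (u l : F)) < ν (f : F) →
        ∀ l, a l ∈ maximalIdeal R) :
    ∃ u : Fin t → R,
      (∀ l, u l ∈ I (i + j)) ∧ (∀ l, ν (u l : F) ≤ ν ((f : F) * (g : F))) ∧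
      ∀ a : Fin t → R, ν (∑ l, (a l : F) * (u l : F)) < ν ((f : F) * (g : F)) →
        ∀ l, a l ∈ maximalIdeal R := by
  obtain ⟨u, huI, huν, hu⟩ := hind
  have hg : 0 < ν (g : F) := zero_lt_iff.mpr ((Valuation.ne_zero_iff ν).mpr hg0)
  refine ⟨fun l => u l * g, fun l => hImul i j (Ideal.mul_mem_mul (huI l) hgI), fun l => ?_,
    fun a ha => hu a ?_⟩
  · simpa only [Subring.coe_mul, map_mul] using mul_le_mul_left (huν l) (ν (g : F))
  · simp only [Subring.coe_mul, ← mul_assoc, ← Finset.sum_mul, map_mul] at ha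
    exact (mul_lt_mul_iff_left₀ hg).mp ha
end

section
/- Let k be a field, A = ⊕_{n≥0} A_n an ℕ-graded commutative domain which is a finitely generated k-algebra such that A_0 is a finite-dimensional k-vector space and A is generated by A_1 as an A_0-algebra, and let L = ⊕_{n≥0} L_n be a graded k-subalgebra of A (L_n ⊆ A_n) with Kodaira–Iitaka dimension κ = κ(L) ≥ 0 and index m = m(L). Then the limit lim_{n→∞} dim_k L_{nm}/n^κ exists. -/
open Filter Topology

lemma tendsto_div_pow_of_superhomogeneous (t : ℕ → ℕ) (q ℓ s₀ : ℕ) (C : ℝ)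
    (hlow : ∀ p j s, 1 ≤ j → s₀ ≤ s → j ^ q * t p ≤ t (j * p + j * ℓ + s))
    (hup : ∀ n, (t n : ℝ) ≤ C * ((n : ℝ) + 1) ^ q) :
    ∃ c : ℝ, Tendsto (fun n : ℕ => (t n : ℝ) / (n : ℝ) ^ q) atTop (𝓝 c) := by
  have hC : 0 ≤ C := by
    have h := hup 0
    simp only [Nat.cast_zero, zero_add, one_pow, mul_one] at h
    exact (Nat.cast_nonneg _).trans h
  have hshift : ∀ a : ℝ, Tendsto (fun n : ℕ => (((n : ℝ) + a) / n) ^ q) atTop (𝓝 1) := by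
    intro a
    have h1 : Tendsto (fun n : ℕ => 1 + a / (n : ℝ)) atTop (𝓝 (1 + 0)) :=
      tendsto_const_nhds.add (tendsto_const_div_atTop_nhds_zero_nat a)
    have h2 := h1.pow q
    simp only [add_zero, one_pow] at h2
    refine h2.congr' ?_
    filter_upwards [eventually_gt_atTop 0] with n hn
    have : (n : ℝ) ≠ 0 := by positivity
    congr 1
    field_simp
  let a : ℕ → ℝ := fun p => (t (p + 1) : ℝ) / ((p : ℝ) + 1 + ℓ) ^ q
  have hbdd : BddAbove (Set.range a) := by
    refine ⟨C * 2 ^ q, ?_⟩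
    rintro _ ⟨p, rfl⟩
    have hpos : (0 : ℝ) < (p : ℝ) + 1 + ℓ := by positivity
    rw [div_le_iff₀ (by positivity)]
    refine (hup _).trans ?_
    rw [mul_assoc, ← mul_pow]
    refine mul_le_mul_of_nonneg_left (pow_le_pow_left₀ (by positivity) ?_ q) hC
    push_cast
    have : (0 : ℝ) ≤ ℓ := by positivity
    have : (0 : ℝ) ≤ p := by positivity
    linarith
  refine ⟨⨆ p, a p, tendsto_order.2 ⟨fun b hb => ?_, fun b hb => ?_⟩⟩
  · obtain ⟨p, hp⟩ := exists_lt_of_lt_ciSup hb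
    have h1 := (hshift (-((s₀ : ℝ) + (p + 1 + ℓ)))).mul_const (a p)
    rw [one_mul] at h1
    filter_upwards [(tendsto_order.1 h1).1 b hp, eventually_ge_atTop (s₀ + (p + 1 + ℓ))]
      with n hn hn2
    refine hn.trans_le ?_
    set j := (n - s₀) / (p + 1 + ℓ) with hj
    have hj1 : 1 ≤ j := by
      rw [hj, Nat.one_le_div_iff (by omega)]
      omega
    have hdm := Nat.div_add_mod (n - s₀) (p + 1 + ℓ)
    have hml := Nat.mod_lt (n - s₀) (show 0 < p + 1 + ℓ by omega)
    rw [← hj] at hdm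
    obtain ⟨s, hs⟩ : ∃ s, s = s₀ + (n - s₀) % (p + 1 + ℓ) := ⟨_, rfl⟩
    have hn' : n = j * (p + 1) + j * ℓ + s := by
      have : j * (p + 1) + j * ℓ = (p + 1 + ℓ) * j := by ring
      omega
    have hlow' := hlow (p + 1) j s hj1 (by omega)
    rw [← hn'] at hlow'
    have hlowR : (j : ℝ) ^ q * t (p + 1) ≤ t n := by exact_mod_cast hlow'
    have hnpos : (0 : ℝ) < n := by
      have : 0 < n := by omega
      exact_mod_cast this
    have hsp : s < s₀ + (p + 1 + ℓ) := by omega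
    have hnR : (n : ℝ) = (p + 1 + ℓ) * j + s := by
      have : n = (p + 1 + ℓ) * j + s := by rw [hn']; ring
      exact_mod_cast this
    have hsR : (s : ℝ) ≤ s₀ + (p + 1 + ℓ) := by exact_mod_cast hsp.le
    have hnR2 : (s₀ : ℝ) + (p + 1 + ℓ) ≤ n := by exact_mod_cast hn2
    have hppos : (0 : ℝ) < (p : ℝ) + 1 + ℓ := by positivity
    rw [div_pow, div_mul_eq_mul_div, div_le_div_iff_of_pos_right (by positivity)]
    refine le_trans ?_ hlowR
    change _ * ((t (p + 1) : ℝ) / ((p : ℝ) + 1 + ℓ) ^ q) ≤ _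
    rw [mul_div_assoc', div_le_iff₀ (by positivity), mul_right_comm, ← mul_pow]
    refine mul_le_mul_of_nonneg_right (pow_le_pow_left₀ ?_ ?_ q) (by positivity)
    · linarith
    · linarith
  · have h1 := (hshift ℓ).const_mul (⨆ p, a p)
    rw [mul_one] at h1
    filter_upwards [(tendsto_order.1 h1).2 b hb, eventually_gt_atTop 0] with n hn hn2
    refine lt_of_le_of_lt ?_ hn
    obtain ⟨p, rfl⟩ : ∃ p, n = p + 1 := ⟨n - 1, by omega⟩
    have hle := le_ciSup hbdd p
    have hpos : (0 : ℝ) < (p : ℝ) + 1 + ℓ := by positivity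
    refine le_trans (le_of_eq ?_) (mul_le_mul_of_nonneg_right hle (by positivity))
    simp only [a, Nat.cast_add, Nat.cast_one]
    rw [div_pow]
    field_simp

lemma tendsto_div_pow_of_superhomogeneous_of_le (t : ℕ → ℕ) (q ℓ s₀ κ : ℕ) (C : ℝ) (hq : q ≤ κ)
    (hlow : ∀ p j s, 1 ≤ j → s₀ ≤ s → j ^ q * t p ≤ t (j * p + j * ℓ + s))
    (hup : ∀ n, (t n : ℝ) ≤ C * ((n : ℝ) + 1) ^ q) :
    ∃ c : ℝ, Tendsto (fun n : ℕ => (t n : ℝ) / (n : ℝ) ^ κ) atTop (𝓝 c) := by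
  obtain ⟨c, hc⟩ := tendsto_div_pow_of_superhomogeneous t q ℓ s₀ C hlow hup
  obtain ⟨e, rfl⟩ := Nat.exists_eq_add_of_le hq
  refine ⟨c * 0 ^ e, (hc.mul ((tendsto_inv_atTop_nhds_zero_nat (𝕜 := ℝ)).pow e)).congr ?_⟩
  intro n
  rw [pow_add, inv_pow, div_mul_eq_div_div, div_eq_mul_inv _ ((n : ℝ) ^ e)]

open scoped MonomialOrder

namespace MonomialOrder

variable {σ k : Type*} [Field k] (o : MonomialOrder σ)

/-- `o.DegLT a b` says that `a` has strictly smaller degree than `b`, the zero polynomial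
having degree smaller than all others. -/
def DegLT (a b : MvPolynomial σ k) : Prop := a = 0 ∨ o.degree a ≺[o] o.degree b

variable {o}

lemma DegLT.mul {a b c d : MvPolynomial σ k} (h : o.DegLT a b) (hb : b ≠ 0)
    (hcd : o.degree c ≼[o] o.degree d) (hd : d ≠ 0) : o.DegLT (c * a) (d * b) := by
  rcases h with rfl | h
  · exact Or.inl (mul_zero _)
  · right
    refine lt_of_le_of_lt (o.degree_mul_le) ?_
    rw [o.degree_mul hd hb, map_add, map_add]
    exact add_lt_add_of_le_of_lt hcd h

lemma DegLT.add {a b c : MvPolynomial σ k} (h : o.DegLT a c) (h' : o.DegLT b c) :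
    o.DegLT (a + b) c := by
  rcases h with rfl | h
  · rwa [zero_add]
  rcases h' with rfl | h'
  · rw [add_zero]; exact Or.inr h
  · exact Or.inr (lt_of_le_of_lt o.degree_add_le (max_lt h h'))

lemma degree_mul_le_degree_mul {a b c d : MvPolynomial σ k} (h : o.degree a ≼[o] o.degree b)
    (hb : b ≠ 0) (hcd : o.degree c ≼[o] o.degree d) (hd : d ≠ 0) :
    o.degree (a * c) ≼[o] o.degree (b * d) := by
  refine o.degree_mul_le.trans ?_
  rw [o.degree_mul hb hd, map_add, map_add]
  exact add_le_add h hcd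

variable (o) (K : Type*) [Field K] [Algebra (MvPolynomial σ k) K]

/-- The subring of fractions `a / b` with `a` of degree at most the degree of `b`. -/
def fractionSubring : Subring K where
  carrier := {x | ∃ a b : MvPolynomial σ k, b ≠ 0 ∧ o.degree a ≼[o] o.degree b ∧
    x * algebraMap _ K b = algebraMap _ K a}
  mul_mem' := by
    rintro x y ⟨a, b, hb, hab, hx⟩ ⟨c, d, hd, hcd, hy⟩
    refine ⟨a * c, b * d, mul_ne_zero hb hd, degree_mul_le_degree_mul hab hb hcd hd, ?_⟩
    rw [map_mul, map_mul, ← hx, ← hy]; ring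
  one_mem' := ⟨1, 1, one_ne_zero, le_rfl, by simp⟩
  add_mem' := by
    rintro x y ⟨a, b, hb, hab, hx⟩ ⟨c, d, hd, hcd, hy⟩
    refine ⟨a * d + b * c, b * d, mul_ne_zero hb hd, ?_, ?_⟩
    · exact o.degree_add_le.trans (max_le (degree_mul_le_degree_mul hab hb le_rfl hd)
        (degree_mul_le_degree_mul le_rfl hb hcd hd))
    · rw [map_mul, map_add, map_mul, map_mul, ← hx, ← hy]; ring
  zero_mem' := ⟨0, 1, one_ne_zero, by simp, by simp⟩
  neg_mem' := by
    rintro x ⟨a, b, hb, hab, hx⟩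
    refine ⟨-a, b, hb, by rwa [degree_neg], by rw [neg_mul, hx, map_neg]⟩

/-- The ideal of fractions `a / b` with `a` of degree smaller than the degree of `b`. -/
def fractionIdeal : Ideal (o.fractionSubring (k := k) K) where
  carrier := {x | ∃ a b : MvPolynomial σ k, b ≠ 0 ∧ o.DegLT a b ∧
    (x : K) * algebraMap _ K b = algebraMap _ K a}
  add_mem' := by
    rintro ⟨x, _⟩ ⟨y, _⟩ ⟨a, b, hb, hab, hx⟩ ⟨c, d, hd, hcd, hy⟩
    refine ⟨d * a + b * c, d * b, mul_ne_zero hd hb, ?_, ?_⟩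
    · refine (hab.mul hb le_rfl hd).add ?_
      rw [mul_comm d b]
      exact hcd.mul hd le_rfl hb
    · change x * _ = _ at hx
      change y * _ = _ at hy
      change (x + y) * _ = _
      rw [map_mul, map_add, map_mul, map_mul, ← hx, ← hy]; ring
  zero_mem' := ⟨0, 1, one_ne_zero, Or.inl rfl, by simp⟩
  smul_mem' := by
    rintro ⟨x, c, d, hd, hcd, hy⟩ ⟨y, _⟩ ⟨a, b, hb, hab, hx⟩
    refine ⟨c * a, d * b, mul_ne_zero hd hb, hab.mul hb hcd hd, ?_⟩
    change y * _ = _ at hx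
    change x * y * _ = _
    rw [map_mul, map_mul, ← hx, ← hy]; ring

lemma exists_valuationSubring [FaithfulSMul (MvPolynomial σ k) K] :
    ∃ O : ValuationSubring K, ∀ a b : MvPolynomial σ k, b ≠ 0 →
      (o.degree a ≼[o] o.degree b →
        O.valuation (algebraMap _ K a) ≤ O.valuation (algebraMap _ K b)) ∧
      (o.DegLT a b → O.valuation (algebraMap _ K a) < O.valuation (algebraMap _ K b)) := by
  have hinj := FaithfulSMul.algebraMap_injective (MvPolynomial σ k) K
  have hI : o.fractionIdeal (k := k) K ≠ ⊤ := by
    rw [Ne, Ideal.eq_top_iff_one]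
    rintro ⟨a, b, hb, hab, h⟩
    rw [Subring.coe_one, one_mul] at h
    obtain rfl := hinj h
    rcases hab with h | h
    · exact hb h
    · exact lt_irrefl _ h
  obtain ⟨O, hO, hOI⟩ := Ideal.image_subset_nonunits_valuationSubring _ hI
  refine ⟨O, fun a b hb => ?_⟩
  have hb' : algebraMap _ K b ≠ 0 := by
    rwa [Ne, map_eq_zero_iff _ hinj]
  have hvb : 0 < O.valuation (algebraMap _ K b) := by
    rw [zero_lt_iff, Ne, map_eq_zero]; exact hb'
  have hx : algebraMap _ K a = (algebraMap _ K a / algebraMap _ K b) * algebraMap _ K b :=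
    (div_mul_cancel₀ _ hb').symm
  have hmem : o.degree a ≼[o] o.degree b →
      algebraMap _ K a / algebraMap _ K b ∈ o.fractionSubring (k := k) K :=
    fun h => ⟨a, b, hb, h, div_mul_cancel₀ _ hb'⟩
  constructor
  · intro h
    rw [hx, map_mul]
    have := (O.valuation_le_one_iff _).2 (hO (hmem h))
    exact mul_le_of_le_one_left' this
  · intro h
    have h' : o.degree a ≼[o] o.degree b := by
      rcases h with rfl | h
      · simp
      · exact h.le
    have h1 : algebraMap _ K a / algebraMap _ K b ∈ O.nonunits :=
      hOI ⟨⟨_, hmem h'⟩, ⟨a, b, hb, h, div_mul_cancel₀ _ hb'⟩, rfl⟩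
    rw [ValuationSubring.mem_nonunits_iff] at h1
    rw [hx, map_mul]
    exact mul_lt_of_lt_one_left hvb h1

end MonomialOrder

section BoundedRepresentation

open Polynomial in
lemma Matrix.totalDegree_coeff_charpoly_le {k σ ι : Type*} [CommRing k] [Fintype ι] [DecidableEq ι]
    (Q : Matrix ι ι (MvPolynomial σ k)) (D : ℕ) (hQ : ∀ i j, (Q i j).totalDegree ≤ D) (n : ℕ) :
    (Q.charpoly.coeff n).totalDegree ≤ Fintype.card ι * D := by
  let Z : ℕ → Set (MvPolynomial σ k)[X] := fun m => {p | ∀ i, (p.coeff i).totalDegree ≤ m}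
  have hmul : ∀ {a b : ℕ} {p q : (MvPolynomial σ k)[X]}, p ∈ Z a → q ∈ Z b → p * q ∈ Z (a + b) := by
    intro a b p q hp hq i
    rw [coeff_mul]
    refine (MvPolynomial.totalDegree_finsetSum_le fun x _ => ?_)
    exact (MvPolynomial.totalDegree_mul _ _).trans (add_le_add (hp _) (hq _))
  have hone : (1 : (MvPolynomial σ k)[X]) ∈ Z 0 := by
    intro i
    rw [coeff_one]
    split_ifs <;> simp
  have hprod : ∀ (s : Finset ι) (g : ι → (MvPolynomial σ k)[X]), (∀ i, g i ∈ Z D) →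
      ∏ i ∈ s, g i ∈ Z (s.card * D) := by
    classical
    intro s g hg
    induction s using Finset.induction_on with
    | empty => simpa using hone
    | insert a s ha ih =>
      rw [Finset.prod_insert ha, Finset.card_insert_of_notMem ha, Nat.succ_mul, add_comm]
      exact hmul (hg a) ih
  have hentry : ∀ i j, Q.charmatrix i j ∈ Z D := by
    intro i j n
    rw [Matrix.charmatrix_apply, coeff_sub, Matrix.diagonal_apply]
    refine (MvPolynomial.totalDegree_sub _ _).trans (max_le ?_ ?_)
    · split_ifs
      · rw [coeff_X]; split_ifs <;> simp
      · simp
    · rw [coeff_C]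
      split_ifs
      · exact hQ i j
      · simp
  rw [Matrix.charpoly, Matrix.det_apply, finsetSum_coeff]
  refine MvPolynomial.totalDegree_finsetSum_le fun τ _ => ?_
  have h := hprod Finset.univ (fun i => Q.charmatrix (τ i) i) (fun i => hentry _ _) n
  rcases Int.units_eq_one_or (Equiv.Perm.sign τ) with h1 | h1
  · rw [h1, one_smul]; exact h
  · rw [h1, Units.neg_smul, one_smul, coeff_neg, MvPolynomial.totalDegree_neg]; exact h

variable {k σ A ι : Type*} [Field k] [CommRing A] [Algebra k A] [Algebra (MvPolynomial σ k) A]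
  [IsScalarTower k (MvPolynomial σ k) A] [Fintype ι] [DecidableEq ι]

/-- The elements of `A` whose multiplication map is represented, with respect to the family `b`,
by a matrix with polynomial entries of total degree at most `D`. -/
def boundedRep (b : ι → A) (D : ℕ) : Submodule k A where
  carrier := {f | ∃ Q : Matrix ι ι (MvPolynomial σ k),
    Q.Represents b (Algebra.lmul (MvPolynomial σ k) A f) ∧ ∀ i j, (Q i j).totalDegree ≤ D}
  add_mem' := by
    rintro f g ⟨Q, hQ, hD⟩ ⟨R, hR, hE⟩
    refine ⟨Q + R, ?_, fun i j => ?_⟩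
    · rw [map_add]; exact hQ.add hR
    · exact (MvPolynomial.totalDegree_add _ _).trans (max_le (hD i j) (hE i j))
  zero_mem' := ⟨0, by rw [map_zero]; exact Matrix.Represents.zero, by simp⟩
  smul_mem' := by
    rintro c f ⟨Q, hQ, hD⟩
    refine ⟨(MvPolynomial.C c : MvPolynomial σ k) • Q, ?_, fun i j => ?_⟩
    · rw [← algebraMap_smul (MvPolynomial σ k) c f, map_smul]
      exact hQ.smul _
    · rw [Matrix.smul_apply, smul_eq_mul]
      refine (MvPolynomial.totalDegree_mul _ _).trans ?_
      rw [MvPolynomial.totalDegree_C, zero_add]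
      exact hD i j

lemma boundedRep_mono (b : ι → A) {D E : ℕ} (h : D ≤ E) :
    boundedRep (k := k) (σ := σ) b D ≤ boundedRep (k := k) (σ := σ) b E :=
  fun _ ⟨Q, hQ, hD⟩ => ⟨Q, hQ, fun i j => (hD i j).trans h⟩

lemma mul_mem_boundedRep (b : ι → A) {D E : ℕ} {f g : A}
    (hf : f ∈ boundedRep (k := k) (σ := σ) b D) (hg : g ∈ boundedRep (k := k) (σ := σ) b E) :
    f * g ∈ boundedRep (k := k) (σ := σ) b (D + E) := by
  obtain ⟨Q, hQ, hD⟩ := hf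
  obtain ⟨R, hR, hE⟩ := hg
  refine ⟨Q * R, ?_, fun i j => ?_⟩
  · rw [map_mul]; exact hQ.mul hR
  · rw [Matrix.mul_apply]
    refine MvPolynomial.totalDegree_finsetSum_le fun l _ => ?_
    exact (MvPolynomial.totalDegree_mul _ _).trans (add_le_add (hD _ _) (hE _ _))

lemma exists_mem_boundedRep (b : ι → A)
    (hb : Submodule.span (MvPolynomial σ k) (Set.range b) = ⊤) (f : A) :
    ∃ D, f ∈ boundedRep (k := k) (σ := σ) b D := by
  obtain ⟨Q, hQ⟩ := Matrix.isRepresentation.toEnd_surjective (MvPolynomial σ k) b hb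
    (Algebra.lmul (MvPolynomial σ k) A f)
  refine ⟨Finset.univ.sup fun x : ι × ι => (Q.1 x.1 x.2).totalDegree, Q.1, ?_, fun i j => ?_⟩
  · rw [← hQ]
    exact Matrix.isRepresentation.toEnd_represents _ b hb Q
  · exact Finset.le_sup (f := fun x : ι × ι => (Q.1 x.1 x.2).totalDegree) (Finset.mem_univ (i, j))

lemma exists_le_boundedRep (b : ι → A)
    (hb : Submodule.span (MvPolynomial σ k) (Set.range b) = ⊤) {V : Submodule k A} (hV : V.FG) :
    ∃ D, V ≤ boundedRep (k := k) (σ := σ) b D := by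
  obtain ⟨s, rfl⟩ := hV
  choose D hD using exists_mem_boundedRep (k := k) (σ := σ) b hb
  refine ⟨s.sup D, Submodule.span_le.2 fun f hf => ?_⟩
  exact boundedRep_mono b (Finset.le_sup hf) (hD f)

lemma mul_pow_le_boundedRep (b : ι → A) {V W : Submodule k A} {D : ℕ}
    (hV : V ≤ boundedRep (k := k) (σ := σ) b D) (hW : W ≤ boundedRep (k := k) (σ := σ) b D)
    (n : ℕ) : V * W ^ n ≤ boundedRep (k := k) (σ := σ) b (D * (n + 1)) := by
  induction n with
  | zero => simpa using hV
  | succ n ih =>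
    rw [pow_succ, ← mul_assoc, Submodule.mul_le]
    intro f hf g hg
    have := mul_mem_boundedRep b (ih hf) (hW hg)
    rwa [← Nat.mul_succ] at this

lemma exists_relation_of_mem_boundedRep (b : ι → A)
    (hb : Submodule.span (MvPolynomial σ k) (Set.range b) = ⊤) {D : ℕ} {f : A}
    (hf : f ∈ boundedRep (k := k) (σ := σ) b D) :
    ∃ p : ℕ → MvPolynomial σ k, p (Fintype.card ι) = 1 ∧
      (∀ i, (p i).totalDegree ≤ Fintype.card ι * D) ∧
      ∑ i ∈ Finset.range (Fintype.card ι + 1), algebraMap _ A (p i) * f ^ i = 0 := by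
  obtain ⟨Q, hQ, hD⟩ := hf
  refine ⟨fun i => Q.charpoly.coeff i, ?_, Q.totalDegree_coeff_charpoly_le D hD, ?_⟩
  · have h := Q.charpoly_monic
    rw [Polynomial.Monic, Polynomial.leadingCoeff, Q.charpoly_natDegree_eq_dim] at h
    exact h
  · let Q' : Matrix.isRepresentation (MvPolynomial σ k) b := ⟨Q, _, hQ⟩
    have h1 : Matrix.isRepresentation.toEnd (MvPolynomial σ k) b hb Q' =
        Algebra.lmul (MvPolynomial σ k) A f :=
      (Matrix.isRepresentation.toEnd_represents _ b hb Q').eq hb hQ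
    have h2 : Polynomial.aeval (Algebra.lmul (MvPolynomial σ k) A f) Q.charpoly = 0 := by
      rw [← h1, Polynomial.aeval_algHom_apply,
        ← map_zero (Matrix.isRepresentation.toEnd (MvPolynomial σ k) b hb)]
      congr 1
      ext1
      rw [Polynomial.aeval_subalgebra_coe, Matrix.aeval_self_charpoly, Subalgebra.coe_zero]
    rw [Polynomial.aeval_algHom_apply] at h2
    have h3 : Polynomial.aeval f Q.charpoly = 0 := by
      have := LinearMap.congr_fun h2 1
      simpa using this
    rw [Polynomial.aeval_eq_sum_range, Q.charpoly_natDegree_eq_dim] at h3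
    simpa only [Algebra.smul_def] using h3

end BoundedRepresentation

section GradedFinite

variable {k A : Type*} [Field k] [CommRing A] [Algebra k A] (𝒜 : ℕ → Submodule k A)
  [GradedAlgebra 𝒜]

lemma GradedAlgebra.proj_mul (n : ℕ) (a b : A) :
    GradedAlgebra.proj 𝒜 n (a * b) =
      ∑ x ∈ Finset.HasAntidiagonal.antidiagonal n,
        GradedAlgebra.proj 𝒜 x.1 a * GradedAlgebra.proj 𝒜 x.2 b := by
  classical
  refine DirectSum.Decomposition.inductionOn 𝒜
    (motive := fun a => GradedAlgebra.proj 𝒜 n (a * b) =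
      ∑ x ∈ Finset.HasAntidiagonal.antidiagonal n,
        GradedAlgebra.proj 𝒜 x.1 a * GradedAlgebra.proj 𝒜 x.2 b)
    (by simp) (fun {i} a => ?_) (fun a a' ha ha' => ?_) a
  swap
  · rw [add_mul, map_add, ha, ha', ← Finset.sum_add_distrib]; simp [add_mul]
  · simp only [GradedAlgebra.proj_apply, DirectSum.coe_decompose_mul_of_left_mem 𝒜 n a.2]
    split_ifs with h
    · rw [Finset.sum_eq_single (i, n - i)]
      · rw [DirectSum.decompose_of_mem_same 𝒜 a.2]
      · rintro ⟨x, y⟩ hxy hne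
        rw [Finset.HasAntidiagonal.mem_antidiagonal] at hxy
        have : i ≠ x := by
          rintro rfl
          exact hne (by ext <;> simp at *; omega)
        rw [DirectSum.decompose_of_mem_ne 𝒜 a.2 this, zero_mul]
      · intro hn
        exact absurd (Finset.HasAntidiagonal.mem_antidiagonal.2 (by simp; omega)) hn
    · refine (Finset.sum_eq_zero ?_).symm
      rintro ⟨x, y⟩ hxy
      rw [Finset.HasAntidiagonal.mem_antidiagonal] at hxy
      have : i ≠ x := by
        rintro rfl
        simp at hxy; omega
      rw [DirectSum.decompose_of_mem_ne 𝒜 a.2 this, zero_mul]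

lemma GradedAlgebra.proj_mem (n : ℕ) (a : A) : GradedAlgebra.proj 𝒜 n a ∈ 𝒜 n := by
  rw [GradedAlgebra.proj_apply]; exact SetLike.coe_mem _

lemma GradedAlgebra.le_of_forall_proj_mem (n : ℕ) (V : Submodule k A)
    (h : ∀ a, GradedAlgebra.proj 𝒜 n a ∈ V) : 𝒜 n ≤ V := by
  intro a ha
  have := h a
  rwa [GradedAlgebra.proj_apply, DirectSum.decompose_of_mem_same 𝒜 ha] at this

lemma GradedAlgebra.fg_one (hFT : Algebra.FiniteType k A) (hA0 : (𝒜 0).FG) : (𝒜 1).FG := by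
  classical
  obtain ⟨s, hs⟩ := hFT.out
  have h00 : 𝒜 0 * 𝒜 0 ≤ 𝒜 0 := Submodule.mul_le.2 fun a ha b hb => SetLike.mul_mem_graded ha hb
  set V := Submodule.span k (s.image (GradedAlgebra.proj 𝒜 1) : Set A) with hV
  have hle : 𝒜 1 ≤ 𝒜 0 * V := by
    refine GradedAlgebra.le_of_forall_proj_mem 𝒜 1 _ fun a => ?_
    have ha : a ∈ Algebra.adjoin k (s : Set A) := hs ▸ Algebra.mem_top
    induction ha using Algebra.adjoin_induction with
    | mem x hx =>
      rw [← one_mul (GradedAlgebra.proj 𝒜 1 x)]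
      exact Submodule.mul_mem_mul SetLike.GradedOne.one_mem
        (Submodule.subset_span (by simpa using ⟨x, hx, rfl⟩))
    | algebraMap r =>
      rw [GradedAlgebra.proj_apply,
        DirectSum.decompose_of_mem_ne 𝒜 (SetLike.algebraMap_mem_graded 𝒜 r) zero_ne_one]
      exact zero_mem _
    | add x y _ _ hx hy => rw [map_add]; exact add_mem hx hy
    | mul x y _ _ hx hy =>
      rw [GradedAlgebra.proj_mul]
      have key : ∀ z w : A, GradedAlgebra.proj 𝒜 1 w ∈ 𝒜 0 * V →
          GradedAlgebra.proj 𝒜 0 z * GradedAlgebra.proj 𝒜 1 w ∈ 𝒜 0 * V := by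
        intro z w hw
        refine (mul_le_mul_left h00 V : 𝒜 0 * 𝒜 0 * V ≤ 𝒜 0 * V) ?_
        rw [mul_assoc]
        exact Submodule.mul_mem_mul (GradedAlgebra.proj_mem 𝒜 0 z) hw
      refine sum_mem fun p hp => ?_
      rw [Finset.HasAntidiagonal.mem_antidiagonal] at hp
      obtain ⟨i, j⟩ := p
      simp only at hp ⊢
      obtain ⟨rfl, rfl⟩ | ⟨rfl, rfl⟩ : (i = 0 ∧ j = 1) ∨ (i = 1 ∧ j = 0) := by omega
      · exact key x y hy
      · rw [mul_comm (GradedAlgebra.proj 𝒜 1 x)]; exact key y x hx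
  have : (𝒜 0 * V).FG := hA0.mul ⟨_, hV.symm⟩
  have : FiniteDimensional k ↥(𝒜 0 * V) := Module.Finite.iff_fg.2 this
  exact Module.Finite.iff_fg.1 (Submodule.finiteDimensional_of_le hle)

lemma GradedAlgebra.le_mul_pow
    (hgen : Algebra.adjoin k ((𝒜 0 : Set A) ∪ (𝒜 1 : Set A)) = ⊤) (n : ℕ) :
    𝒜 n ≤ 𝒜 0 * 𝒜 1 ^ n := by
  classical
  have h00 : 𝒜 0 * 𝒜 0 ≤ 𝒜 0 := Submodule.mul_le.2 fun a ha b hb => SetLike.mul_mem_graded ha hb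
  have h1 : (1 : A) ∈ 𝒜 0 := SetLike.GradedOne.one_mem
  have hmain : ∀ a : A, ∀ n, GradedAlgebra.proj 𝒜 n a ∈ 𝒜 0 * 𝒜 1 ^ n := by
    intro a
    have ha : a ∈ Algebra.adjoin k ((𝒜 0 : Set A) ∪ (𝒜 1 : Set A)) := hgen ▸ Algebra.mem_top
    have hzero : ∀ x ∈ 𝒜 0, ∀ n, GradedAlgebra.proj 𝒜 n x ∈ 𝒜 0 * 𝒜 1 ^ n := by
      intro x hx n
      rw [GradedAlgebra.proj_apply]
      rcases eq_or_ne 0 n with rfl | hn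
      · rw [DirectSum.decompose_of_mem_same 𝒜 hx]; simpa using hx
      · rw [DirectSum.decompose_of_mem_ne 𝒜 hx hn]; exact zero_mem _
    induction ha using Algebra.adjoin_induction with
    | mem x hx =>
      rcases hx with hx | hx
      · exact hzero x hx
      · intro n
        rw [GradedAlgebra.proj_apply]
        rcases eq_or_ne 1 n with rfl | hn
        · rw [DirectSum.decompose_of_mem_same 𝒜 hx, pow_one, ← one_mul x]
          exact Submodule.mul_mem_mul h1 hx
        · rw [DirectSum.decompose_of_mem_ne 𝒜 hx hn]; exact zero_mem _
    | algebraMap r => exact hzero _ (SetLike.algebraMap_mem_graded 𝒜 r)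
    | add x y _ _ hx hy => intro n; rw [map_add]; exact add_mem (hx n) (hy n)
    | mul x y _ _ hx hy =>
      intro n
      rw [GradedAlgebra.proj_mul]
      refine sum_mem fun p hp => ?_
      rw [Finset.HasAntidiagonal.mem_antidiagonal] at hp
      rw [← hp, pow_add]
      have := Submodule.mul_mem_mul (hx p.1) (hy p.2)
      rw [mul_mul_mul_comm] at this
      exact (mul_le_mul_left h00 _ : 𝒜 0 * 𝒜 0 * _ ≤ 𝒜 0 * _) this
  exact GradedAlgebra.le_of_forall_proj_mem 𝒜 n _ fun a => hmain a n

lemma GradedAlgebra.finiteDimensional_component (hFT : Algebra.FiniteType k A)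
    (hA0 : FiniteDimensional k (𝒜 0))
    (hgen : Algebra.adjoin k ((𝒜 0 : Set A) ∪ (𝒜 1 : Set A)) = ⊤) (n : ℕ) :
    FiniteDimensional k (𝒜 n) := by
  have h0 : (𝒜 0).FG := Module.Finite.iff_fg.1 hA0
  have : FiniteDimensional k ↥(𝒜 0 * 𝒜 1 ^ n) :=
    Module.Finite.iff_fg.2 (h0.mul ((GradedAlgebra.fg_one 𝒜 hFT h0).pow n))
  exact Submodule.finiteDimensional_of_le (GradedAlgebra.le_mul_pow 𝒜 hgen n)

end GradedFinite

section Orthogonal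

variable {A Γ : Type*} [CommRing A] [LinearOrderedCommGroupWithZero Γ]

/-- A finite family is orthogonal if the value of a linear combination is at least the value of
each of its terms. -/
def Valuation.Orthogonal (k : Type*) [Field k] [Algebra k A] (v : Valuation A Γ) {ι : Type*}
    [Fintype ι] (u : ι → A) : Prop :=
  ∀ (c : ι → k) (i : ι), c i ≠ 0 → v (u i) ≤ v (∑ j, c j • u j)

lemma Valuation.exists_ne_map_eq_of_sum_eq_zero (v : Valuation A Γ) {ι : Type*} {s : Finset ι}
    {x : ι → A} (hsum : ∑ i ∈ s, x i = 0) {i₀ : ι} (hi₀ : i₀ ∈ s) (hx : v (x i₀) ≠ 0) :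
    ∃ i ∈ s, ∃ j ∈ s, i ≠ j ∧ v (x i) ≠ 0 ∧ v (x i) = v (x j) := by
  classical
  obtain ⟨j, hj, hmax⟩ := s.exists_max_image (fun i => v (x i)) ⟨i₀, hi₀⟩
  have hj0 : v (x j) ≠ 0 := by
    have := hmax i₀ hi₀
    rw [← zero_lt_iff] at hx ⊢
    exact hx.trans_le this
  by_contra! hcon
  have h := v.map_sum_eq_of_lt hj (f := x) (fun i hi => by
    rw [Finset.mem_sdiff, Finset.mem_singleton] at hi
    exact lt_of_le_of_ne (hmax i hi.1)
      fun h => hcon j hj i hi.1 (Ne.symm hi.2) hj0 h.symm)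
  rw [hsum, map_zero] at h
  exact hj0 h.symm

/-- `w` is a function with values in a lattice `ℤ^d` that separates the values of `v`, turns
products into sums, and such that orthogonal families of constant value have at most `F`
elements. -/
structure Valuation.IsLatticeValue (k : Type*) [Field k] [Algebra k A] (v : Valuation A Γ) {d : ℕ}
    (w : A → Fin d → ℤ) (F : ℕ) : Prop where
  ne_zero : ∀ f : A, f ≠ 0 → v f ≠ 0
  map_algebraMap : ∀ c : k, c ≠ 0 → v (algebraMap k A c) = 1
  eq_iff : ∀ f g : A, f ≠ 0 → g ≠ 0 → (w f = w g ↔ v f = v g)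
  value_mul : ∀ f g : A, f ≠ 0 → g ≠ 0 → w (f * g) = w f + w g
  card_le : ∀ (ι : Type) [Fintype ι] (u : ι → A), v.Orthogonal k u → (∀ i, u i ≠ 0) →
    (∀ i j, v (u i) = v (u j)) → Fintype.card ι ≤ F

end Orthogonal

section Abhyankar

open scoped Nat

variable {k A Γ : Type*} [Field k] [CommRing A] [LinearOrderedCommGroupWithZero Γ] {σ : Type*}
  {o : MonomialOrder σ} [Algebra (MvPolynomial σ k) A]

/-- The valuation `v` of `A` compares polynomials in the same way as the monomial order `o`. -/
structure MonomialOrder.Compatible (o : MonomialOrder σ) (k : Type*) [Field k]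
    [Algebra (MvPolynomial σ k) A] (v : Valuation A Γ) : Prop where
  ne_zero : ∀ f : A, f ≠ 0 → v f ≠ 0
  map_le : ∀ a b : MvPolynomial σ k, b ≠ 0 → o.degree a ≼[o] o.degree b →
    v (algebraMap _ A a) ≤ v (algebraMap _ A b)
  map_lt : ∀ a b : MvPolynomial σ k, b ≠ 0 → o.DegLT a b →
    v (algebraMap _ A a) < v (algebraMap _ A b)

namespace MonomialOrder.Compatible

variable {v : Valuation A Γ} (h : o.Compatible k v)
include h

lemma map_ne_zero {a : MvPolynomial σ k} (ha : a ≠ 0) : v (algebraMap _ A a) ≠ 0 :=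
  (_root_.zero_le.trans_lt (h.map_lt 0 a ha (Or.inl rfl))).ne'

lemma map_eq_iff {a b : MvPolynomial σ k} (ha : a ≠ 0) (hb : b ≠ 0) :
    v (algebraMap _ A a) = v (algebraMap _ A b) ↔ o.degree a = o.degree b := by
  constructor
  · intro hab
    apply o.toSyn.injective
    apply le_antisymm
    · by_contra hlt
      exact (h.map_lt b a ha (Or.inr (not_le.1 hlt))).ne hab.symm
    · by_contra hlt
      exact (h.map_lt a b hb (Or.inr (not_le.1 hlt))).ne hab
  · intro hab
    exact le_antisymm (h.map_le a b hb (by rw [hab])) (h.map_le b a ha (by rw [hab]))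

lemma map_algebraMap [Algebra k A] [IsScalarTower k (MvPolynomial σ k) A] {c : k} (hc : c ≠ 0) : v (algebraMap k A c) = 1 := by
  rw [IsScalarTower.algebraMap_apply k (MvPolynomial σ k) A]
  have : v (algebraMap (MvPolynomial σ k) A 1) = 1 := by rw [map_one, map_one]
  rw [← this, h.map_eq_iff _ one_ne_zero, MvPolynomial.algebraMap_eq, degree_C, degree_one]
  rwa [MvPolynomial.algebraMap_eq, Ne, MvPolynomial.C_eq_zero]

lemma linearIndependent_of_orthogonal [Algebra k A] [IsScalarTower k (MvPolynomial σ k) A]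
    {ι : Type*} [Fintype ι] {u : ι → A} (hu : v.Orthogonal k u) (hu0 : ∀ i, u i ≠ 0)
    (hval : ∀ i j, v (u i) = v (u j)) : LinearIndependent (MvPolynomial σ k) u := by
  classical
  rw [Fintype.linearIndependent_iff]
  intro g hg
  by_contra! hcon
  obtain ⟨i₁, hi₁⟩ := hcon
  obtain ⟨i₀, hi₀, hmax⟩ := (Finset.univ.filter fun i => g i ≠ 0).exists_max_image
    (fun i => o.toSyn (o.degree (g i))) ⟨i₁, by simpa using hi₁⟩
  simp only [Finset.mem_filter, Finset.mem_univ, true_and] at hi₀ hmax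
  set D := o.degree (g i₀) with hD
  let mon : MvPolynomial σ k := MvPolynomial.monomial D 1
  have hmon0 : mon ≠ 0 := by simp [mon]
  have hmonD : o.degree mon = D := by
    classical
    simp [mon, degree_monomial]
  let r : ι → MvPolynomial σ k := fun i => g i - MvPolynomial.C ((g i).coeff D) * mon
  have hr : ∀ i, o.DegLT (r i) mon := by
    intro i
    by_cases hri : r i = 0
    · exact Or.inl hri
    right
    rw [hmonD]
    have hle : o.toSyn (o.degree (r i)) ≤ o.toSyn D := by
      refine degree_sub_le.trans (max_le ?_ ?_)
      · by_cases hgi : g i = 0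
        · simp [hgi]
        · exact hmax i hgi
      · refine degree_mul_le.trans ?_
        rw [degree_C, zero_add, hmonD]
    refine lt_of_le_of_ne hle fun heq => ?_
    have heq' := o.toSyn.injective heq
    have hc : (r i).coeff D = 0 := by
      simp [r, mon, MvPolynomial.coeff_C_mul]
    rw [← heq'] at hc
    exact hri (coeff_degree_eq_zero_iff.1 hc)
  have hsplit : ∑ i, g i • u i =
      algebraMap _ A mon * ∑ i, ((g i).coeff D) • u i + ∑ i, algebraMap _ A (r i) * u i := by
    rw [Finset.mul_sum, ← Finset.sum_add_distrib]
    refine Finset.sum_congr rfl fun i _ => ?_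
    rw [Algebra.smul_def, Algebra.smul_def, IsScalarTower.algebraMap_apply k (MvPolynomial σ k) A,
      MvPolynomial.algebraMap_eq]
    simp only [r, map_sub, map_mul]
    ring
  have hγ : v (algebraMap _ A mon) * v (u i₀) ≠ 0 :=
    mul_ne_zero (h.map_ne_zero hmon0) (h.ne_zero _ (hu0 i₀))
  have h1 : v (algebraMap _ A mon) * v (u i₀) ≤
      v (algebraMap _ A mon * ∑ i, ((g i).coeff D) • u i) := by
    rw [map_mul]
    gcongr
    exact hu _ i₀ (by rw [hD, Ne, coeff_degree_eq_zero_iff]; exact hi₀)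
  have h2 : v (∑ i, algebraMap _ A (r i) * u i) < v (algebraMap _ A mon) * v (u i₀) := by
    refine v.map_sum_lt hγ fun i _ => ?_
    rw [map_mul, hval i i₀]
    exact mul_lt_mul_of_pos_right (h.map_lt _ _ hmon0 (hr i))
      (zero_lt_iff.2 (h.ne_zero _ (hu0 i₀)))
  have h3 := v.map_add_eq_of_lt_left (h2.trans_le h1)
  rw [← hsplit, hg, map_zero] at h3
  rw [← h3] at h1
  exact hγ (le_antisymm h1 _root_.zero_le)

lemma exists_pow_relation [NoZeroDivisors A] {N E : ℕ} {f : A} (hf : f ≠ 0)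
    {p : ℕ → MvPolynomial σ k} (hpN : p N = 1) (hpE : ∀ i, (p i).totalDegree ≤ E)
    (hsum : ∑ i ∈ Finset.range (N + 1), algebraMap _ A (p i) * f ^ i = 0) :
    ∃ a b : MvPolynomial σ k, a ≠ 0 ∧ b ≠ 0 ∧ a.totalDegree ≤ N ! * E ∧ b.totalDegree ≤ N ! * E ∧
      v f ^ N ! * v (algebraMap _ A b) = v (algebraMap _ A a) := by
  have hvf := h.ne_zero f hf
  obtain ⟨i, hi, j, hj, hij, hv0, hveq⟩ := v.exists_ne_map_eq_of_sum_eq_zero hsum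
    (Finset.mem_range.2 (Nat.lt_succ_self N))
    (by rw [hpN, map_one, one_mul, map_pow]; exact pow_ne_zero _ hvf)
  wlog hlt : i < j generalizing i j
  · exact this j hj i hi hij.symm (hveq ▸ hv0) hveq.symm (by omega)
  rw [Finset.mem_range] at hi hj
  have hnz : ∀ l, v (algebraMap _ A (p l) * f ^ l) ≠ 0 → p l ≠ 0 := by
    rintro l hl h0
    simp [h0] at hl
  have hpi := hnz i hv0
  have hpj := hnz j (hveq ▸ hv0)
  obtain ⟨s, hs⟩ := Nat.exists_eq_add_of_lt hlt
  obtain ⟨e, he⟩ : (s + 1) ∣ N ! := Nat.dvd_factorial (Nat.succ_pos s) (by omega)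
  have hrel : v f ^ (s + 1) * v (algebraMap _ A (p j)) = v (algebraMap _ A (p i)) := by
    rw [map_mul, map_mul, map_pow, map_pow, hs, add_assoc, pow_add] at hveq
    apply mul_right_cancel₀ (pow_ne_zero i hvf)
    rw [hveq]
    have : v f ^ (s + 1) * v (algebraMap _ A (p (i + (s + 1)))) * v f ^ i =
      v (algebraMap _ A (p (i + (s + 1)))) * (v f ^ i * v f ^ (s + 1)) := by ac_rfl
    rw [hs, add_assoc]
    exact this
  have hele : e ≤ N ! := Nat.le_of_dvd (Nat.factorial_pos N) ⟨s + 1, by rw [he, mul_comm]⟩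
  refine ⟨p i ^ e, p j ^ e, pow_ne_zero _ hpi, pow_ne_zero _ hpj, ?_, ?_, ?_⟩
  · exact (MvPolynomial.totalDegree_pow _ _).trans (Nat.mul_le_mul hele (hpE i))
  · exact (MvPolynomial.totalDegree_pow _ _).trans (Nat.mul_le_mul hele (hpE j))
  · rw [he, pow_mul, map_pow, map_pow, map_pow, map_pow, ← mul_pow, hrel]

end MonomialOrder.Compatible

end Abhyankar

section LatticeValue

open scoped Nat

variable {k A Γ : Type*} [Field k] [CommRing A] [LinearOrderedCommGroupWithZero Γ]

/-- The quotient `a / b` represents the `M`-th power of the value of `f`. -/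
def MonomialOrder.Represents {d : ℕ} [Algebra (MvPolynomial (Fin d) k) A] (v : Valuation A Γ)
    (M : ℕ) (f : A) (a b : MvPolynomial (Fin d) k) : Prop :=
  a ≠ 0 ∧ b ≠ 0 ∧ v f ^ M * v (algebraMap _ A b) = v (algebraMap _ A a)

lemma MonomialOrder.degree_apply_le_totalDegree {σ : Type*} (o : MonomialOrder σ)
    {a : MvPolynomial σ k} (ha : a ≠ 0) (i : σ) : o.degree a i ≤ a.totalDegree := by
  have h := MvPolynomial.le_totalDegree (o.degree_mem_support ha)
  exact (Finsupp.le_degree i _).trans h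

lemma MonomialOrder.Compatible.eq_iff_of_represents {d : ℕ} [Algebra (MvPolynomial (Fin d) k) A]
    {v : Valuation A Γ} {o : MonomialOrder (Fin d)} (h : o.Compatible k v) {M : ℕ} (hM : M ≠ 0)
    {f g : A} {a b a' b' : MvPolynomial (Fin d) k} (hf : MonomialOrder.Represents v M f a b)
    (hg : MonomialOrder.Represents v M g a' b') :
    ((fun i => (o.degree a i : ℤ) - o.degree b i) = fun i => (o.degree a' i : ℤ) - o.degree b' i) ↔
      v f = v g := by
  obtain ⟨ha, hb, hab⟩ := hf
  obtain ⟨ha', hb', hab'⟩ := hg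
  have h1 : ((fun i => (o.degree a i : ℤ) - o.degree b i) =
      fun i => (o.degree a' i : ℤ) - o.degree b' i) ↔ o.degree (a * b') = o.degree (a' * b) := by
    rw [degree_mul ha hb', degree_mul ha' hb, funext_iff, DFunLike.ext_iff]
    refine forall_congr' fun i => ?_
    rw [Finsupp.add_apply, Finsupp.add_apply]
    omega
  rw [h1, ← h.map_eq_iff (mul_ne_zero ha hb') (mul_ne_zero ha' hb), map_mul, map_mul, map_mul,
    map_mul, ← hab, ← hab', mul_right_comm, mul_right_comm (v g ^ M), mul_assoc, mul_assoc,
    mul_comm (v _) (v _)]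
  have hne := mul_ne_zero (h.map_ne_zero hb) (h.map_ne_zero hb')
  rw [mul_left_inj' hne]
  exact pow_left_inj₀ _root_.zero_le _root_.zero_le hM

lemma MonomialOrder.Compatible.exists_isLatticeValue [IsDomain A] [Algebra k A] {d : ℕ}
    [Algebra (MvPolynomial (Fin d) k) A] [IsScalarTower k (MvPolynomial (Fin d) k) A]
    [Module.Finite (MvPolynomial (Fin d) k) A]
    {v : Valuation A Γ} {o : MonomialOrder (Fin d)} (h : o.Compatible k v)
    (𝒜 : ℕ → Submodule k A) {V W : Submodule k A} (hV : V.FG) (hW : W.FG)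
    (h𝒜 : ∀ n, 𝒜 n ≤ V * W ^ n) :
    ∃ (w : A → Fin d → ℤ) (F C : ℕ), v.IsLatticeValue k w F ∧
      ∀ n, ∀ f ∈ 𝒜 n, f ≠ 0 → ∀ i, |w f i| ≤ C * (n + 1) := by
  classical
  obtain ⟨N, b, hb⟩ := Module.Finite.exists_fin (R := MvPolynomial (Fin d) k) (M := A)
  obtain ⟨D₁, hD₁⟩ := exists_le_boundedRep b hb hV
  obtain ⟨D₂, hD₂⟩ := exists_le_boundedRep b hb hW
  have hM : N ! ≠ 0 := Nat.factorial_ne_zero N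
  have hbound : ∀ n, ∀ f ∈ 𝒜 n, f ∈ boundedRep (k := k) (σ := Fin d) b (max D₁ D₂ * (n + 1)) := by
    intro n f hf
    exact mul_pow_le_boundedRep b (hD₁.trans (boundedRep_mono b (le_max_left _ _)))
      (hD₂.trans (boundedRep_mono b (le_max_right _ _))) n (h𝒜 n hf)
  have hrep : ∀ D, ∀ f ∈ boundedRep (k := k) (σ := Fin d) b D, f ≠ 0 →
      ∃ p q : MvPolynomial (Fin d) k, MonomialOrder.Represents v (N !) f p q ∧
        p.totalDegree ≤ N ! * (N * D) ∧ q.totalDegree ≤ N ! * (N * D) := by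
    intro D f hf hf0
    obtain ⟨p, hp1, hpD, hsum⟩ := exists_relation_of_mem_boundedRep b hb hf
    rw [Fintype.card_fin] at hp1 hpD hsum
    obtain ⟨a, b, ha, hb, hda, hdb, hab⟩ := h.exists_pow_relation hf0 hp1 hpD hsum
    exact ⟨a, b, ⟨ha, hb, hab⟩, hda, hdb⟩
  have hrep' : ∀ f : A, ∃ p q : MvPolynomial (Fin d) k, f ≠ 0 →
      MonomialOrder.Represents v (N !) f p q := by
    intro f
    by_cases hf : f = 0
    · exact ⟨0, 0, fun h => absurd hf h⟩
    · obtain ⟨D, hD⟩ := exists_mem_boundedRep b hb f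
      obtain ⟨p, q, hpq, -⟩ := hrep D f hD hf
      exact ⟨p, q, fun _ => hpq⟩
  choose p q hpq using hrep'
  refine ⟨fun f i => (o.degree (p f) i : ℤ) - o.degree (q f) i,
    Module.finrank (MvPolynomial (Fin d) k) A, N ! * (N * max D₁ D₂), ⟨h.ne_zero,
      fun c hc => h.map_algebraMap hc, fun f g hf hg => h.eq_iff_of_represents hM (hpq f hf) (hpq g hg),
      fun f g hf hg => ?_, fun ι _ u hu hu0 hval => ?_⟩, fun n f hf hf0 i => ?_⟩
  · have hp : MonomialOrder.Represents v (N !) (f * g) (p f * p g) (q f * q g) := by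
      refine ⟨mul_ne_zero (hpq f hf).1 (hpq g hg).1, mul_ne_zero (hpq f hf).2.1 (hpq g hg).2.1, ?_⟩
      rw [map_mul, map_mul, map_mul, map_mul, map_mul, ← (hpq f hf).2.2, ← (hpq g hg).2.2, mul_pow]
      ac_rfl
    have := (h.eq_iff_of_represents hM (hpq (f * g) (mul_ne_zero hf hg)) hp).2 rfl
    rw [this]
    funext i
    rw [degree_mul (hpq f hf).1 (hpq g hg).1, degree_mul (hpq f hf).2.1 (hpq g hg).2.1,
      Finsupp.add_apply, Finsupp.add_apply, Pi.add_apply]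
    push_cast
    ring
  · exact (h.linearIndependent_of_orthogonal hu hu0 hval).fintype_card_le_finrank
  · obtain ⟨a, b, hab, hda, hdb⟩ := hrep _ f (hbound n f hf) hf0
    have := congr_fun ((h.eq_iff_of_represents hM (hpq f hf0) hab).2 rfl) i
    beta_reduce at this ⊢
    rw [this]
    have h1 := (o.degree_apply_le_totalDegree hab.1 i).trans hda
    have h2 := (o.degree_apply_le_totalDegree hab.2.1 i).trans hdb
    rw [← mul_assoc, ← mul_assoc] at h1 h2
    rw [← mul_assoc]
    rw [abs_le]
    zify at h1 h2
    push_cast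
    constructor <;> linarith

theorem exists_isLatticeValue {k A : Type*} [Field k] [CommRing A] [IsDomain A] [Algebra k A]
    (𝒜 : ℕ → Submodule k A) (hFT : Algebra.FiniteType k A) {V W : Submodule k A} (hV : V.FG)
    (hW : W.FG) (h𝒜 : ∀ n, 𝒜 n ≤ V * W ^ n) :
    ∃ (O : ValuationSubring (FractionRing A)) (d : ℕ) (w : A → Fin d → ℤ) (F C : ℕ),
      (O.valuation.comap (algebraMap A (FractionRing A))).IsLatticeValue k w F ∧
      ∀ n, ∀ f ∈ 𝒜 n, f ≠ 0 → ∀ i, |w f i| ≤ C * (n + 1) := by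
  obtain ⟨d, g, hg, hfin⟩ := exists_finite_inj_algHom_of_fg k A
  let : Algebra (MvPolynomial (Fin d) k) A := g.toRingHom.toAlgebra
  have : IsScalarTower k (MvPolynomial (Fin d) k) A :=
    IsScalarTower.of_algebraMap_eq fun c => (g.commutes c).symm
  have : Module.Finite (MvPolynomial (Fin d) k) A := hfin
  have : FaithfulSMul (MvPolynomial (Fin d) k) A :=
    (faithfulSMul_iff_algebraMap_injective _ _).2 hg
  have : FaithfulSMul (MvPolynomial (Fin d) k) (FractionRing A) := by
    rw [faithfulSMul_iff_algebraMap_injective,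
      IsScalarTower.algebraMap_eq (MvPolynomial (Fin d) k) A (FractionRing A)]
    exact (IsFractionRing.injective A (FractionRing A)).comp hg
  let o : MonomialOrder (Fin d) := MonomialOrder.lex
  obtain ⟨O, hO⟩ := o.exists_valuationSubring (k := k) (FractionRing A)
  have htower : ∀ a : MvPolynomial (Fin d) k, algebraMap A (FractionRing A) (algebraMap _ A a) =
      algebraMap _ (FractionRing A) a := fun a =>
    (IsScalarTower.algebraMap_apply (MvPolynomial (Fin d) k) A (FractionRing A) a).symm
  have hcomp : o.Compatible k (O.valuation.comap (algebraMap A (FractionRing A))) := by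
    refine ⟨fun f hf => ?_, fun a b hb hab => ?_, fun a b hb hab => ?_⟩
    · rw [Valuation.comap_apply, Valuation.ne_zero_iff]
      exact (map_ne_zero_iff _ (IsFractionRing.injective A (FractionRing A))).2 hf
    · rw [Valuation.comap_apply, Valuation.comap_apply, htower, htower]
      exact (hO a b hb).1 hab
    · rw [Valuation.comap_apply, Valuation.comap_apply, htower, htower]
      exact (hO a b hb).2 hab
  obtain ⟨w, F, C, hw, hC⟩ := hcomp.exists_isLatticeValue 𝒜 hV hW h𝒜
  exact ⟨O, d, w, F, C, hw, hC⟩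

end LatticeValue

namespace Valuation.IsLatticeValue

variable {k A Γ : Type*} [Field k] [CommRing A] [Algebra k A] [LinearOrderedCommGroupWithZero Γ]
  {v : Valuation A Γ} {d F : ℕ} {w : A → Fin d → ℤ} (h : v.IsLatticeValue k w F)
include h

lemma map_smul {c : k} (hc : c ≠ 0) (f : A) : v (c • f) = v f := by
  rw [Algebra.smul_def, map_mul, h.map_algebraMap c hc, one_mul]

lemma linearIndependent_of_injective {ι : Type*} {x : ι → A} (hx0 : ∀ i, x i ≠ 0)
    (hx : Function.Injective fun i => v (x i)) : LinearIndependent k x := by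
  classical
  rw [linearIndependent_iff']
  intro s c hsum
  by_contra! hcon
  obtain ⟨i₀, hi₀, hc₀⟩ := hcon
  have hc : ∀ i, v (c i • x i) ≠ 0 → v (c i • x i) = v (x i) := by
    intro i hi
    refine h.map_smul (fun h0 => ?_) _
    simp [h0] at hi
  obtain ⟨i, -, j, -, hij, hv0, hv⟩ := v.exists_ne_map_eq_of_sum_eq_zero hsum hi₀
    (by rw [h.map_smul hc₀]; exact h.ne_zero _ (hx0 i₀))
  exact hij (hx (((hc i hv0).symm.trans hv).trans (hc j (hv ▸ hv0))))

lemma linearIndependent_of_orthogonal {ι : Type*} [Fintype ι] {u : ι → A}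
    (hu : v.Orthogonal k u) (hu0 : ∀ i, u i ≠ 0) : LinearIndependent k u := by
  rw [Fintype.linearIndependent_iff]
  intro c hc i
  by_contra hci
  have := hu c i hci
  rw [hc, map_zero] at this
  exact h.ne_zero _ (hu0 i) (le_antisymm this _root_.zero_le)

lemma finite_values (V : Submodule k A) [FiniteDimensional k V] :
    {γ : Γ | ∃ f ∈ V, f ≠ 0 ∧ v f = γ}.Finite := by
  choose x hxV hx0 hxv using fun γ : {γ : Γ | ∃ f ∈ V, f ≠ 0 ∧ v f = γ} => γ.2
  have hli : LinearIndependent k x := h.linearIndependent_of_injective hx0 fun γ δ hγδ => by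
    apply Subtype.ext
    exact (hxv γ).symm.trans (hγδ.trans (hxv δ))
  have hli' : LinearIndependent k fun γ => (⟨x γ, hxV γ⟩ : V) :=
    LinearIndependent.of_comp V.subtype hli
  have := hli'.finite
  exact Set.toFinite _

lemma exists_orthogonal (V : Submodule k A) [FiniteDimensional k V] :
    ∃ u : Fin (Module.finrank k V) → A, v.Orthogonal k u ∧ (∀ i, u i ≠ 0) ∧ ∀ i, u i ∈ V := by
  suffices H : ∀ n ≤ Module.finrank k V, ∃ u : Fin n → A, v.Orthogonal k u ∧ (∀ i, u i ≠ 0) ∧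
      ∀ i, u i ∈ V from H _ le_rfl
  intro n
  induction n with
  | zero => exact fun _ => ⟨Fin.elim0, fun _ i => i.elim0, fun i => i.elim0, fun i => i.elim0⟩
  | succ n ih =>
    intro hn
    obtain ⟨u, hu, hu0, huV⟩ := ih (by omega)
    let U := Submodule.span k (Set.range u)
    have hUV : U ≤ V := Submodule.span_le.2 (by rintro _ ⟨i, rfl⟩; exact huV i)
    have hex : ∃ f ∈ V, f ∉ U := by
      by_contra! hcon
      have h1 : U = V := le_antisymm hUV hcon
      have h2 : Module.finrank k U ≤ n := (finrank_range_le_card u).trans (by simp)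
      rw [h1] at h2
      omega
    have hnz : ∀ f, f ∉ U → f ≠ 0 := fun f hf h0 => hf (h0 ▸ U.zero_mem)
    have hfin : {γ : Γ | ∃ f ∈ V, f ∉ U ∧ v f = γ}.Finite :=
      (h.finite_values V).subset fun γ ⟨f, hf, hfU, hγ⟩ => ⟨f, hf, hnz f hfU, hγ⟩
    obtain ⟨f₁, hf₁, hf₁U⟩ := hex
    obtain ⟨γ, ⟨f, hfV, hfU, rfl⟩, hmin⟩ := hfin.exists_minimal ⟨_, f₁, hf₁, hf₁U, rfl⟩
    have hmin' : ∀ g ∈ V, g ∉ U → v f ≤ v g := by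
      intro g hg hgU
      by_contra! hlt
      exact absurd (hmin ⟨g, hg, hgU, rfl⟩ hlt.le) hlt.not_ge
    refine ⟨Fin.snoc u f, fun c => ?_, ?_, ?_⟩
    · have hgU : ∑ i : Fin n, c i.castSucc • u i ∈ U :=
        Submodule.sum_mem _ fun i _ => U.smul_mem _ (Submodule.subset_span ⟨i, rfl⟩)
      have hgu : ∀ i : Fin n, c i.castSucc ≠ 0 → v (u i) ≤ v (∑ i : Fin n, c i.castSucc • u i) :=
        fun i hi => hu (fun i => c i.castSucc) i hi
      simp only [Fin.sum_univ_castSucc, Fin.snoc_castSucc, Fin.snoc_last]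
      set g := ∑ i : Fin n, c i.castSucc • u i
      by_cases hc : c (Fin.last n) = 0
      · intro i
        refine Fin.lastCases (fun h0 => absurd hc h0) (fun i hi => ?_) i
        rw [Fin.snoc_castSucc, hc, zero_smul, add_zero]
        exact hgu i hi
      · have hfg : v f ≤ v (g + c (Fin.last n) • f) := by
          refine hmin' _ (V.add_mem (hUV hgU) (V.smul_mem _ hfV)) fun hmem => hfU ?_
          have := (U.smul_mem_iff hc).1 ((U.add_mem_iff_right hgU).1 hmem)
          exact this
        intro i
        refine Fin.lastCases (fun _ => ?_) (fun i hi => ?_) i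
        · rwa [Fin.snoc_last]
        · rw [Fin.snoc_castSucc]
          rcases le_or_gt (v g) (v f) with hle | hlt
          · exact (hgu i hi).trans (hle.trans hfg)
          · rw [v.map_add_eq_of_lt_left (by rwa [h.map_smul hc])]
            exact hgu i hi
    · intro i
      refine Fin.lastCases ?_ (fun i => ?_) i
      · rw [Fin.snoc_last]; exact hnz f hfU
      · rw [Fin.snoc_castSucc]; exact hu0 i
    · intro i
      refine Fin.lastCases ?_ (fun i => ?_) i
      · rw [Fin.snoc_last]; exact hfV
      · rw [Fin.snoc_castSucc]; exact huV i

end Valuation.IsLatticeValue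

namespace Valuation

variable {k A Γ : Type*} [Field k] [CommRing A] [Algebra k A] [LinearOrderedCommGroupWithZero Γ]
  {v : Valuation A Γ}

lemma Orthogonal.comp_injective {ι ι' : Type*} [Fintype ι] [Fintype ι'] {u : ι → A}
    (hu : v.Orthogonal k u) {e : ι' → ι} (he : Function.Injective e) : v.Orthogonal k (u ∘ e) := by
  intro c i hi
  have hsum : ∑ j, c j • (u ∘ e) j = ∑ j, Function.extend e c 0 j • u j := by
    refine Fintype.sum_of_injective e he _ _ (fun j hj => ?_) fun j => ?_
    · rw [Function.extend_apply' _ _ _ (by simpa using hj), Pi.zero_apply, zero_smul]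
    · rw [he.extend_apply, Function.comp_apply]
  rw [hsum]
  exact hu _ (e i) (by rwa [he.extend_apply])

namespace IsLatticeValue

variable {d F : ℕ} {w : A → Fin d → ℤ} (h : v.IsLatticeValue k w F)
include h

lemma map_sum_eq {ι : Type*} [Fintype ι] {u : ι → A} (hu : v.Orthogonal k u) {c : ι → k} {γ : Γ}
    {i : ι} (hi : c i ≠ 0) (hγ : ∀ j, c j ≠ 0 → v (u j) = γ) : v (∑ j, c j • u j) = γ := by
  apply le_antisymm
  · refine v.map_sum_le fun j _ => ?_
    by_cases hj : c j = 0
    · simp [hj]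
    · rw [h.map_smul hj, hγ j hj]
  · rw [← hγ i hi]
    exact hu c i hi

lemma value_one [Nontrivial A] : w 1 = 0 := by
  simpa using h.value_mul 1 1 one_ne_zero one_ne_zero

variable [IsDomain A]

lemma value_pow {f : A} (hf : f ≠ 0) (n : ℕ) : w (f ^ n) = n • w f := by
  induction n with
  | zero => rw [pow_zero, zero_smul, h.value_one]
  | succ n ih => rw [pow_succ, h.value_mul _ _ (pow_ne_zero n hf) hf, ih, succ_nsmul]

lemma value_prod {ι : Type*} (s : Finset ι) {f : ι → A} (hf : ∀ i, f i ≠ 0) :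
    w (∏ i ∈ s, f i) = ∑ i ∈ s, w (f i) := by
  classical
  induction s using Finset.induction_on with
  | empty => rw [Finset.prod_empty, Finset.sum_empty, h.value_one]
  | insert a s ha ih =>
    rw [Finset.prod_insert ha, Finset.sum_insert ha,
      h.value_mul _ _ (hf a) (Finset.prod_ne_zero_iff.2 fun i _ => hf i), ih]

/-- The subgroup generated by the differences of the values of two elements of the same degree. -/
def valueGroup (M : ℕ → Submodule k A) [SetLike.GradedMonoid M] : AddSubgroup (Fin d → ℤ) where
  carrier := {x | ∃ n, ∃ f ∈ M n, ∃ g ∈ M n, f ≠ 0 ∧ g ≠ 0 ∧ x = w f - w g}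
  zero_mem' := ⟨0, 1, SetLike.one_mem_graded M, 1, SetLike.one_mem_graded M, one_ne_zero,
    one_ne_zero, (sub_self _).symm⟩
  neg_mem' := by
    rintro x ⟨n, f, hf, g, hg, hf0, hg0, rfl⟩
    exact ⟨n, g, hg, f, hf, hg0, hf0, neg_sub _ _⟩
  add_mem' := by
    rintro x y ⟨n, f, hf, g, hg, hf0, hg0, rfl⟩ ⟨n', f', hf', g', hg', hf0', hg0', rfl⟩
    refine ⟨n + n', f * f', SetLike.mul_mem_graded hf hf', g * g', SetLike.mul_mem_graded hg hg',
      mul_ne_zero hf0 hf0', mul_ne_zero hg0 hg0', ?_⟩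
    rw [h.value_mul _ _ hf0 hf0', h.value_mul _ _ hg0 hg0']
    abel

end IsLatticeValue

end Valuation

lemma Submodule.exists_finset_card_le_finrank {d : ℕ} (G : Submodule ℤ (Fin d → ℤ)) :
    ∃ T : Finset (Fin d), T.card ≤ Module.finrank ℤ G ∧
      ∀ x ∈ G, (∀ i ∈ T, x i = 0) → x = 0 := by
  classical
  obtain ⟨T, hT, hmin⟩ := (Set.toFinite
    {T : Finset (Fin d) | ∀ x ∈ G, (∀ i ∈ T, x i = 0) → x = 0}).exists_minimal
    ⟨Finset.univ, fun x _ hx => funext fun i => hx i (Finset.mem_univ i)⟩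
  refine ⟨T, ?_, hT⟩
  have hex : ∀ t : T, ∃ x : G, (∀ i ∈ T, i ≠ t → x.1 i = 0) ∧ x.1 t ≠ 0 := by
    rintro ⟨t, ht⟩
    by_contra! hcon
    have := hmin (y := T.erase t) (fun x hx hx0 => ?_) (Finset.erase_subset t T)
    · exact Finset.notMem_erase t T (this ht)
    · have h0 : ∀ i ∈ T, i ≠ t → x i = 0 := fun i hi hit => hx0 i (Finset.mem_erase.2 ⟨hit, hi⟩)
      refine hT x hx fun i hi => ?_
      by_cases hit : i = t
      · rw [hit]; exact hcon ⟨x, hx⟩ h0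
      · exact h0 i hi hit
  choose x hx0 hx1 using hex
  have hli : LinearIndependent ℤ x := by
    rw [Fintype.linearIndependent_iff]
    intro c hc t
    have h1 : ∑ s, c s * (x s).1 t = 0 := by
      have := congrArg (fun y : G => y.1 t) hc
      simpa [Finset.sum_apply] using this
    rw [Finset.sum_eq_single t (fun s _ hst => by
      rw [hx0 s t t.2 (fun h => hst (Subtype.ext h.symm)), mul_zero]) (by simp)] at h1
    exact (mul_eq_zero.1 h1).resolve_right (hx1 t)
  simpa using hli.fintype_card_le_finrank

namespace Valuation.IsLatticeValue

variable {k A Γ : Type*} [Field k] [CommRing A] [IsDomain A] [Algebra k A]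
  [LinearOrderedCommGroupWithZero Γ] {v : Valuation A Γ} {d F : ℕ} {w : A → Fin d → ℤ}
  (h : v.IsLatticeValue k w F) (M : ℕ → Submodule k A) [SetLike.GradedMonoid M]
include h

/-- The rank of the group of differences of values. -/
noncomputable def valueRank : ℕ := Module.finrank ℤ (AddSubgroup.toIntSubmodule (h.valueGroup M))

lemma finrank_le (n C : ℕ) [FiniteDimensional k (M n)]
    (hC : ∀ f ∈ M n, f ≠ 0 → ∀ i, |w f i| ≤ C * (n + 1)) :
    Module.finrank k (M n) ≤ F * (2 * (C * (n + 1)) + 1) ^ h.valueRank M := by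
  classical
  obtain ⟨T, hT, hinj⟩ := Submodule.exists_finset_card_le_finrank
    (AddSubgroup.toIntSubmodule (h.valueGroup M))
  obtain ⟨u, hu, hu0, huM⟩ := h.exists_orthogonal (M n)
  let φ : Fin (Module.finrank k (M n)) → T → ℤ := fun i t => w (u i) t
  let B : Finset (T → ℤ) := Fintype.piFinset fun _ => Finset.Icc (-(C * (n + 1) : ℤ)) (C * (n + 1))
  have hφ : ∀ i ∈ Finset.univ, φ i ∈ B := by
    intro i _
    rw [Fintype.mem_piFinset]
    intro t
    rw [Finset.mem_Icc, ← abs_le]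
    exact hC _ (huM i) (hu0 i) t
  have hfib : ∀ x ∈ B, (Finset.univ.filter fun i => φ i = x).card ≤ F := by
    intro x _
    have := h.card_le (Finset.univ.filter fun i => φ i = x) (u ∘ Subtype.val)
      (hu.comp_injective Subtype.val_injective) (fun i => hu0 _) ?_
    · rwa [Fintype.card_coe] at this
    · rintro ⟨i, hi⟩ ⟨j, hj⟩
      simp only [Finset.mem_filter, Finset.mem_univ, true_and] at hi hj
      refine (h.eq_iff _ _ (hu0 i) (hu0 j)).1 (sub_eq_zero.1 (hinj _ ?_ fun t ht => ?_))
      · exact ⟨n, u i, huM i, u j, huM j, hu0 i, hu0 j, rfl⟩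
      · rw [Pi.sub_apply, sub_eq_zero]
        exact congr_fun (hi.trans hj.symm) ⟨t, ht⟩
  have hcard := Finset.card_le_mul_card_image_of_maps_to hφ F hfib
  rw [Finset.card_univ, Fintype.card_fin] at hcard
  refine hcard.trans (Nat.mul_le_mul_left F ?_)
  rw [Fintype.card_piFinset, Finset.prod_const, Finset.card_univ, Fintype.card_coe, Int.card_Icc]
  have : ((C * (n + 1) : ℤ) + 1 - -(C * (n + 1) : ℤ)).toNat = 2 * (C * (n + 1)) + 1 := by
    have hcast : (C * (n + 1) : ℤ) = ((C * (n + 1) : ℕ) : ℤ) := by push_cast; rfl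
    rw [hcast]
    omega
  rw [this]
  exact Nat.pow_le_pow_right (Nat.succ_pos _) hT

end Valuation.IsLatticeValue

namespace Valuation.IsLatticeValue

variable {k A Γ : Type*} [Field k] [CommRing A] [IsDomain A] [Algebra k A]
  [LinearOrderedCommGroupWithZero Γ] {v : Valuation A Γ} {d F : ℕ} {w : A → Fin d → ℤ}
  (h : v.IsLatticeValue k w F) (M : ℕ → Submodule k A) [SetLike.GradedMonoid M]
include h

lemma exists_basis_valueGroup : ∃ (a b : Fin (h.valueRank M) → A) (N : Fin (h.valueRank M) → ℕ),
    (∀ l, a l ∈ M (N l)) ∧ (∀ l, b l ∈ M (N l)) ∧ (∀ l, a l ≠ 0) ∧ (∀ l, b l ≠ 0) ∧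
    LinearIndependent ℤ (fun l => w (a l) - w (b l)) ∧
    ∀ x ∈ h.valueGroup M, ∃ c : Fin (h.valueRank M) → ℤ, x = ∑ l, c l • (w (a l) - w (b l)) := by
  let G := AddSubgroup.toIntSubmodule (h.valueGroup M)
  let e : Module.Basis (Fin (h.valueRank M)) ℤ G := Module.finBasis ℤ G
  have he : ∀ l, (e l : Fin d → ℤ) ∈ h.valueGroup M := fun l => (e l).2
  choose N a ha b hb ha0 hb0 hab using he
  have hab' : (fun l => w (a l) - w (b l)) = fun l => (e l : Fin d → ℤ) :=
    funext fun l => (hab l).symm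
  refine ⟨a, b, N, ha, hb, ha0, hb0, ?_, fun x hx => ⟨fun l => e.repr ⟨x, hx⟩ l, ?_⟩⟩
  · rw [hab']
    exact e.linearIndependent.map' G.subtype (Submodule.ker_subtype G)
  · simp only [← hab]
    have := congrArg G.subtype (e.sum_repr ⟨x, hx⟩)
    rw [map_sum] at this
    exact this.symm

lemma pow_mul_finrank_le {q : ℕ} {a b : Fin q → A} {N : Fin q → ℕ} (ha : ∀ l, a l ∈ M (N l))
    (hb : ∀ l, b l ∈ M (N l)) (ha0 : ∀ l, a l ≠ 0) (hb0 : ∀ l, b l ≠ 0)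
    (hli : LinearIndependent ℤ (fun l => w (a l) - w (b l)))
    (hspan : ∀ x ∈ h.valueGroup M, ∃ c : Fin q → ℤ, x = ∑ l, c l • (w (a l) - w (b l)))
    (p j s : ℕ) (hj : 1 ≤ j) (hs : M s ≠ ⊥) [FiniteDimensional k (M p)]
    [FiniteDimensional k (M (j * p + j * ∑ l, N l + s))] :
    j ^ q * Module.finrank k (M p) ≤ Module.finrank k (M (j * p + j * ∑ l, N l + s)) := by
  classical
  obtain ⟨g, hg, hg0⟩ := (Submodule.ne_bot_iff _).1 hs
  obtain ⟨u, hu, hu0, huM⟩ := h.exists_orthogonal (M p)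
  have hR : ∀ γ : Γ, ∃ r, (∃ i, v (u i) = γ) → r ∈ M p ∧ r ≠ 0 ∧ v r = γ := by
    intro γ
    by_cases hγ : ∃ i, v (u i) = γ
    · obtain ⟨i, hi⟩ := hγ
      exact ⟨u i, fun _ => ⟨huM i, hu0 i, hi⟩⟩
    · exact ⟨0, fun h => absurd h hγ⟩
  choose R hR using hR
  let z : Γ → (Fin q → Fin j) → A := fun γ c =>
    R γ ^ (j - 1) * (∏ l, a l ^ (c l : ℕ) * b l ^ (j - c l : ℕ)) * g
  have hP0 : ∀ (c : Fin q → Fin j) l, a l ^ (c l : ℕ) * b l ^ (j - c l : ℕ) ≠ 0 :=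
    fun c l => mul_ne_zero (pow_ne_zero _ (ha0 l)) (pow_ne_zero _ (hb0 l))
  have hP0' : ∀ c : Fin q → Fin j, ∏ l, a l ^ (c l : ℕ) * b l ^ (j - c l : ℕ) ≠ 0 :=
    fun c => Finset.prod_ne_zero_iff.2 fun l _ => hP0 c l
  have hPM : ∀ c : Fin q → Fin j, ∏ l, a l ^ (c l : ℕ) * b l ^ (j - c l : ℕ) ∈ M (j * ∑ l, N l) := by
    intro c
    rw [Finset.mul_sum]
    refine SetLike.prod_mem_graded M _ _ fun l _ => ?_
    have := SetLike.mul_mem_graded (SetLike.pow_mem_graded (c l : ℕ) (ha l))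
      (SetLike.pow_mem_graded (j - c l : ℕ) (hb l))
    rwa [smul_eq_mul, smul_eq_mul, ← add_mul, Nat.add_sub_cancel' (c l).2.le] at this
  have hz0 : ∀ i c, z (v (u i)) c ≠ 0 := fun i c =>
    mul_ne_zero (mul_ne_zero (pow_ne_zero _ (hR _ ⟨i, rfl⟩).2.1) (hP0' c)) hg0
  let y : Fin (Module.finrank k (M p)) × (Fin q → Fin j) → A := fun x => z (v (u x.1)) x.2 * u x.1
  have hyM : ∀ x, y x ∈ M (j * p + j * ∑ l, N l + s) := by
    rintro ⟨i, c⟩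
    have h1 := SetLike.mul_mem_graded (huM i) (SetLike.mul_mem_graded (SetLike.mul_mem_graded
      (SetLike.pow_mem_graded (j - 1) (hR _ ⟨i, rfl⟩).1) (hPM c)) hg)
    have h2 : p + ((j - 1) • p + j * ∑ l, N l + s) = j * p + j * ∑ l, N l + s := by
      obtain ⟨j, rfl⟩ := Nat.exists_eq_add_of_le hj
      rw [Nat.add_sub_cancel_left, smul_eq_mul]
      ring
    rw [h2, mul_comm (u i)] at h1
    exact h1
  have hwy : ∀ i c r, r ≠ 0 → v r = v (u i) → w (z (v (u i)) c * r) =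
      j • w (u i) + ∑ l, (c l : ℕ) • (w (a l) - w (b l)) + (∑ l, j • w (b l) + w g) := by
    intro i c r hr hvr
    have h1 : w (R (v (u i))) = w (u i) :=
      (h.eq_iff _ _ (hR _ ⟨i, rfl⟩).2.1 (hu0 i)).2 (hR _ ⟨i, rfl⟩).2.2
    have h2 : w r = w (u i) := (h.eq_iff _ _ hr (hu0 i)).2 hvr
    have h3 : ∀ l, w (a l ^ (c l : ℕ) * b l ^ (j - c l : ℕ)) =
        (c l : ℕ) • (w (a l) - w (b l)) + j • w (b l) := by
      intro l
      rw [h.value_mul _ _ (pow_ne_zero _ (ha0 l)) (pow_ne_zero _ (hb0 l)), h.value_pow (ha0 l),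
        h.value_pow (hb0 l)]
      have hj' : (j - c l : ℕ) • w (b l) + (c l : ℕ) • w (b l) = j • w (b l) := by
        rw [← add_smul, Nat.sub_add_cancel (c l).2.le]
      rw [← hj', smul_sub]
      abel
    have hR0 := (hR _ ⟨i, rfl⟩ : R (v (u i)) ∈ M p ∧ _ ∧ _).2.1
    rw [h.value_mul _ _ (hz0 i c) hr,
      h.value_mul _ _ (mul_ne_zero (pow_ne_zero _ hR0) (hP0' c)) hg0,
      h.value_mul _ _ (pow_ne_zero _ hR0) (hP0' c), h.value_pow hR0, h.value_prod _ (hP0 c), h1, h2,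
      Finset.sum_congr rfl fun l _ => h3 l, Finset.sum_add_distrib]
    obtain ⟨t, rfl⟩ := Nat.exists_eq_add_of_le hj
    rw [Nat.add_sub_cancel_left, add_smul 1 t, one_smul]
    abel
  have hdist : ∀ i i' (c c' : Fin q → Fin j), j • w (u i) + ∑ l, (c l : ℕ) • (w (a l) - w (b l)) =
      j • w (u i') + ∑ l, (c' l : ℕ) • (w (a l) - w (b l)) → v (u i) = v (u i') ∧ c = c' := by
    intro i i' c c' heq
    obtain ⟨x, hx⟩ := hspan (w (u i) - w (u i')) ⟨p, u i, huM i, u i', huM i', hu0 i, hu0 i', rfl⟩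
    have h1 : ∑ l, ((j : ℤ) * x l + (c l - c' l)) • (w (a l) - w (b l)) = 0 := by
      simp only [add_smul, sub_smul, mul_smul, Finset.sum_add_distrib, Finset.sum_sub_distrib]
      rw [← Finset.smul_sum, ← hx]
      simp only [natCast_zsmul]
      rw [smul_sub]
      rw [← sub_eq_zero] at heq
      rw [← heq]
      abel
    have h2 := Fintype.linearIndependent_iff.1 hli _ h1
    have h3 : ∀ l, x l = 0 := by
      intro l
      have hl := h2 l
      have hc := (c l).2
      have hc' := (c' l).2
      by_contra hx0
      rcases lt_or_gt_of_ne hx0 with hneg | hpos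
      · have : (j : ℤ) * x l ≤ (j : ℤ) * (-1) := mul_le_mul_of_nonneg_left (by omega) (by omega)
        omega
      · have : (j : ℤ) * 1 ≤ (j : ℤ) * x l := mul_le_mul_of_nonneg_left (by omega) (by omega)
        omega
    constructor
    · refine (h.eq_iff _ _ (hu0 i) (hu0 i')).1 (sub_eq_zero.1 ?_)
      rw [hx]
      exact Finset.sum_eq_zero fun l _ => by rw [h3 l, zero_smul]
    · funext l
      have hl := h2 l
      rw [h3 l] at hl
      apply Fin.ext
      omega
  have hlin : LinearIndependent k y := by
    rw [Fintype.linearIndependent_iff]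
    intro α hα
    by_contra! hcon
    obtain ⟨⟨i₀, c₀⟩, hα₀⟩ := hcon
    let I : Finset (Γ × (Fin q → Fin j)) := (Finset.univ.image fun i => v (u i)) ×ˢ Finset.univ
    let β : Γ × (Fin q → Fin j) → Fin (Module.finrank k (M p)) → k :=
      fun t i => if v (u i) = t.1 then α (i, t.2) else 0
    let S : Γ × (Fin q → Fin j) → A := fun t => z t.1 t.2 * ∑ i, β t i • u i
    have hS : ∑ t ∈ I, S t = 0 := by
      rw [← hα, Finset.sum_product_right, Fintype.sum_prod_type_right]
      refine Finset.sum_congr rfl fun c _ => ?_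
      simp only [S, β, Finset.mul_sum, ite_smul, zero_smul, mul_ite, mul_zero]
      rw [Finset.sum_comm]
      refine Finset.sum_congr rfl fun i _ => ?_
      rw [Finset.sum_ite_eq, if_pos (Finset.mem_image_of_mem _ (Finset.mem_univ i))]
      simp only [y]
      rw [mul_smul_comm]
    have hβγ : ∀ t i, β t i ≠ 0 → v (u i) = t.1 := by
      intro t i hi
      by_contra hne
      exact hi (if_neg hne)
    have hSv : ∀ t i, β t i ≠ 0 → v (∑ i, β t i • u i) = v (u i) := fun t i hi =>
      h.map_sum_eq hu hi fun j' hj' => (hβγ t j' hj').trans (hβγ t i hi).symm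
    have hSex : ∀ t, v (S t) ≠ 0 → ∃ i, β t i ≠ 0 := by
      intro t ht
      by_contra! hcon
      simp [S, hcon] at ht
    have hSw : ∀ t i, β t i ≠ 0 → S t ≠ 0 ∧
        w (S t) = j • w (u i) + ∑ l, (t.2 l : ℕ) • (w (a l) - w (b l)) +
          (∑ l, j • w (b l) + w g) := by
      intro t i hi
      have h1 := hSv t i hi
      have h2 : ∑ i, β t i • u i ≠ 0 := by
        intro h0
        rw [h0, map_zero] at h1
        exact h.ne_zero _ (hu0 i) h1.symm
      simp only [S]
      rw [← hβγ t i hi]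
      exact ⟨mul_ne_zero (hz0 i _) h2, hwy i t.2 _ h2 h1⟩
    have hβ₀ : β (v (u i₀), c₀) i₀ ≠ 0 := by simpa [β] using hα₀
    obtain ⟨t, ht, t', ht', htt', hv0, hvv⟩ := v.exists_ne_map_eq_of_sum_eq_zero hS
      (i₀ := (v (u i₀), c₀)) (Finset.mem_product.2
        ⟨Finset.mem_image_of_mem _ (Finset.mem_univ i₀), Finset.mem_univ _⟩)
      (h.ne_zero _ (hSw _ i₀ hβ₀).1)
    obtain ⟨i, hi⟩ := hSex t hv0
    obtain ⟨i', hi'⟩ := hSex t' (hvv ▸ hv0)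
    obtain ⟨hS0, hSw1⟩ := hSw t i hi
    obtain ⟨hS0', hSw1'⟩ := hSw t' i' hi'
    have hww := (h.eq_iff _ _ hS0 hS0').2 hvv
    rw [hSw1, hSw1', add_left_inj] at hww
    obtain ⟨h1, h2⟩ := hdist i i' t.2 t'.2 hww
    exact htt' (Prod.ext (by rw [← hβγ t i hi, ← hβγ t' i' hi', h1]) h2)
  have hlin' : LinearIndependent k
      fun x => (⟨y x, hyM x⟩ : M (j * p + j * ∑ l, N l + s)) :=
    LinearIndependent.of_comp (M (j * p + j * ∑ l, N l + s)).subtype hlin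
  have hcard := hlin'.fintype_card_le_finrank
  rwa [Fintype.card_prod, Fintype.card_fun, Fintype.card_fin, Fintype.card_fin, Fintype.card_fin,
    mul_comm] at hcard

end Valuation.IsLatticeValue

namespace Valuation.IsLatticeValue

variable {k A Γ : Type*} [Field k] [CommRing A] [IsDomain A] [Algebra k A]
  [LinearOrderedCommGroupWithZero Γ] {v : Valuation A Γ} {d F : ℕ} {w : A → Fin d → ℤ}
  (h : v.IsLatticeValue k w F)
include h

lemma algebraicIndependent (𝒜 : ℕ → Submodule k A) [GradedAlgebra 𝒜] {D : ℕ} (hD : 0 < D)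
    {ι : Type*} [Fintype ι] {f : ι → A} (hf : ∀ i, f i ∈ 𝒜 D) (hf0 : ∀ i, f i ≠ 0)
    (hw : ∀ c : ι → ℤ, ∑ i, c i = 0 → ∑ i, c i • w (f i) = 0 → c = 0) :
    AlgebraicIndependent k f := by
  classical
  rw [algebraicIndependent_iff]
  intro p hp
  by_contra hp0
  obtain ⟨s₀, hs₀⟩ := MvPolynomial.support_nonempty.2 hp0
  let x : (ι →₀ ℕ) → A := fun s => ∏ i, f i ^ s i
  have hx0 : ∀ s, x s ≠ 0 := fun s => Finset.prod_ne_zero_iff.2 fun i _ => pow_ne_zero _ (hf0 i)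
  have hxw : ∀ s, w (x s) = ∑ i, s i • w (f i) := by
    intro s
    rw [h.value_prod _ fun i => pow_ne_zero _ (hf0 i)]
    exact Finset.sum_congr rfl fun i _ => h.value_pow (hf0 i) _
  have hx𝒜 : ∀ s, x s ∈ 𝒜 ((∑ i, s i) * D) := by
    intro s
    have := SetLike.prod_pow_mem_graded 𝒜 (F := Finset.univ) (i := fun _ : ι => D) (g := f) s
      fun i _ => hf i
    rwa [Finset.sum_mul]
  have hsum : ∑ s ∈ p.support, p.coeff s • x s = 0 := by
    rw [MvPolynomial.aeval_def, MvPolynomial.eval₂_eq'] at hp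
    simpa only [Algebra.smul_def] using hp
  have hsum' : ∑ s ∈ p.support with ∑ i, s i = ∑ i, s₀ i, p.coeff s • x s = 0 := by
    have h1 := congrArg (GradedAlgebra.proj 𝒜 ((∑ i, s₀ i) * D)) hsum
    rw [map_sum, map_zero] at h1
    rw [← h1, Finset.sum_filter]
    refine Finset.sum_congr rfl fun s _ => ?_
    rw [_root_.map_smul, GradedAlgebra.proj_apply]
    split_ifs with hs
    · rw [DirectSum.decompose_of_mem_same 𝒜 (hs ▸ hx𝒜 s)]
    · rw [DirectSum.decompose_of_mem_ne 𝒜 (hx𝒜 s) fun h0 => hs (Nat.eq_of_mul_eq_mul_right hD h0),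
        smul_zero]
  have hv : ∀ s ∈ p.support, v (p.coeff s • x s) = v (x s) := fun s hs =>
    h.map_smul (MvPolynomial.mem_support_iff.1 hs) _
  obtain ⟨s, hs, t, ht, hst, -, hvv⟩ := v.exists_ne_map_eq_of_sum_eq_zero hsum'
    (Finset.mem_filter.2 ⟨hs₀, rfl⟩) (by rw [hv _ hs₀]; exact h.ne_zero _ (hx0 _))
  rw [Finset.mem_filter] at hs ht
  rw [hv s hs.1, hv t ht.1, ← h.eq_iff _ _ (hx0 s) (hx0 t), hxw, hxw] at hvv
  have hc := hw (fun i => (s i : ℤ) - t i) ?_ ?_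
  · refine hst (Finsupp.ext fun i => ?_)
    have := congr_fun hc i
    rw [Pi.zero_apply] at this
    omega
  · rw [Finset.sum_sub_distrib, ← Nat.cast_sum, ← Nat.cast_sum, hs.2, ht.2, sub_self]
  · simp only [sub_smul, natCast_zsmul, Finset.sum_sub_distrib]
    rw [hvv, sub_self]

lemma exists_algebraicIndependent (M 𝒜 : ℕ → Submodule k A) [SetLike.GradedMonoid M]
    [GradedAlgebra 𝒜] {m : ℕ} (hm : 0 < m) (hM : ∀ n, M n ≤ 𝒜 (n * m)) {t : ℕ} (ht : 0 < t)
    (hMt : M t ≠ ⊥) {q : ℕ} {a b : Fin q → A} {N : Fin q → ℕ} (ha : ∀ l, a l ∈ M (N l))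
    (hb : ∀ l, b l ∈ M (N l)) (ha0 : ∀ l, a l ≠ 0) (hb0 : ∀ l, b l ≠ 0)
    (hli : LinearIndependent ℤ (fun l => w (a l) - w (b l))) :
    ∃ (f : Fin (q + 1) → A) (D : ℕ), 0 < D ∧ (∀ i, f i ∈ M D) ∧ AlgebraicIndependent k f := by
  classical
  obtain ⟨g, hg, hg0⟩ := (Submodule.ne_bot_iff _).1 hMt
  let c : Fin (q + 1) → Fin q → A :=
    Fin.cons b fun l => Function.update b l (a l)
  have hc : ∀ i l, c i l ∈ M (N l) ∧ c i l ≠ 0 := by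
    intro i l
    refine Fin.cases ⟨hb l, hb0 l⟩ (fun j => ?_) i
    simp only [c, Fin.cons_succ, Function.update_apply]
    split_ifs with hlj
    · subst hlj; exact ⟨ha _, ha0 _⟩
    · exact ⟨hb l, hb0 l⟩
  let f : Fin (q + 1) → A := fun i => (∏ l, c i l) * g
  have hf : ∀ i, f i ∈ M (∑ l, N l + t) := fun i =>
    SetLike.mul_mem_graded (SetLike.prod_mem_graded M _ _ fun l _ => (hc i l).1) hg
  have hf0 : ∀ i, f i ≠ 0 := fun i =>
    mul_ne_zero (Finset.prod_ne_zero_iff.2 fun l _ => (hc i l).2) hg0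
  have hfw : ∀ i, w (f i) = ∑ l, w (c i l) + w g := by
    intro i
    rw [h.value_mul _ _ (Finset.prod_ne_zero_iff.2 fun l _ => (hc i l).2) hg0,
      h.value_prod _ fun l => (hc i l).2]
  have hfw' : ∀ l : Fin q, w (f l.succ) = (w (a l) - w (b l)) + w (f 0) := by
    intro l
    have h1 : ∑ l', w (c l.succ l') - ∑ l', w (c 0 l') = w (a l) - w (b l) := by
      rw [← Finset.sum_sub_distrib, Finset.sum_eq_single l]
      · simp [c]
      · intro l' _ hne
        simp [c, hne]
      · simp
    rw [hfw, hfw, ← h1]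
    abel
  refine ⟨f, _, Nat.add_pos_right _ ht, hf, h.algebraicIndependent 𝒜
    (D := (∑ l, N l + t) * m) (Nat.mul_pos (Nat.add_pos_right _ ht) hm)
    (fun i => hM _ (hf i)) hf0 fun e he hew => ?_⟩
  rw [Fin.sum_univ_succ] at he hew
  simp only [hfw', smul_add, Finset.sum_add_distrib, ← Finset.sum_smul] at hew
  rw [add_left_comm, ← add_smul, he, zero_smul, add_zero] at hew
  have h1 := Fintype.linearIndependent_iff.1 hli _ hew
  simp only [h1, Finset.sum_const_zero, add_zero] at he
  funext i
  exact Fin.cases he h1 i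

end Valuation.IsLatticeValue

lemma Submodule.exists_forall_mul_ne_bot {k A : Type*} [Field k] [CommRing A] [IsDomain A]
    [Algebra k A] (L : ℕ → Submodule k A) [SetLike.GradedMonoid L] {m : ℕ}
    (hidx : AddSubgroup.closure ((fun n : ℕ => (n : ℤ)) '' {n : ℕ | L n ≠ ⊥})
      = AddSubgroup.zmultiples (m : ℤ)) :
    ∃ s₀, ∀ s ≥ s₀, 0 < m → L (s * m) ≠ ⊥ := by
  set S : Set ℕ := {n : ℕ | L n ≠ ⊥} with hS
  let T : AddSubmonoid ℕ :=
    { carrier := S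
      zero_mem' := (Submodule.ne_bot_iff _).2 ⟨1, SetLike.one_mem_graded L, one_ne_zero⟩
      add_mem' := by
        intro i j hi hj
        obtain ⟨x, hx, hx0⟩ := (Submodule.ne_bot_iff _).1 hi
        obtain ⟨y, hy, hy0⟩ := (Submodule.ne_bot_iff _).1 hj
        exact (Submodule.ne_bot_iff _).2
          ⟨x * y, SetLike.mul_mem_graded hx hy, mul_ne_zero hx0 hy0⟩ }
  have hgcd : Nat.setGcd S ∣ m := by
    have h1 : (m : ℤ) ∈ AddSubgroup.closure ((fun n : ℕ => (n : ℤ)) '' S) := by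
      rw [hidx]; exact AddSubgroup.mem_zmultiples _
    have h2 : AddSubgroup.closure ((fun n : ℕ => (n : ℤ)) '' S) ≤
        AddSubgroup.zmultiples (Nat.setGcd S : ℤ) := by
      rw [AddSubgroup.closure_le]
      rintro _ ⟨n, hn, rfl⟩
      exact Int.mem_zmultiples_iff.2 (Int.natCast_dvd_natCast.2 (Nat.setGcd_dvd_of_mem hn))
    exact Int.natCast_dvd_natCast.1 (Int.mem_zmultiples_iff.1 (h2 h1))
  obtain ⟨n₀, hn₀⟩ := Nat.exists_mem_closure_of_ge S
  refine ⟨n₀, fun s hs hm => ?_⟩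
  have h1 := hn₀ (s * m) (hs.trans (Nat.le_mul_of_pos_right s hm)) (hgcd.mul_left s)
  exact AddSubmonoid.closure_le (S := T).2 (fun _ h => h) h1

/-- Let `k` be a field and `A = ⊕_{n≥0} A_n` an `ℕ`-graded commutative domain which is a
finitely generated `k`-algebra with `A_0` finite dimensional over `k` and `A` generated by
`A_1` as an `A_0`-algebra (the section ring of an ample line bundle on a projective variety).
Let `L = ⊕ L_n` be a graded `k`-subalgebra of `A` (a graded linear series) of Kodaira–Iitaka
dimension `κ = κ(L) ≥ 0` (i.e. some `κ+1`, but no `κ+2`, homogeneous elements of positive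
degree of `L` are algebraically independent over `k`), with index `m = m(L)` (the positive
generator of the subgroup of `ℤ` generated by `{n : L_n ≠ 0}`).  Then
`lim_{n→∞} dim_k L_{nm}/n^κ` exists. -/
theorem statement15 (k : Type*) [Field k] (A : Type*) [CommRing A] [IsDomain A] [Algebra k A]
    (𝒜 : ℕ → Submodule k A) [GradedAlgebra 𝒜]
    (hFT : Algebra.FiniteType k A)
    (hA0 : FiniteDimensional k ↥(𝒜 0))
    (hgen : Algebra.adjoin k ((𝒜 0 : Set A) ∪ (𝒜 1 : Set A)) = ⊤)
    (L : ℕ → Submodule k A) (hL : ∀ n, L n ≤ 𝒜 n) (hL1 : (1 : A) ∈ L 0)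
    (hLmul : ∀ i j, ∀ x ∈ L i, ∀ y ∈ L j, x * y ∈ L (i + j))
    (κ : ℕ)
    (hκ1 : ∃ f : Fin (κ + 1) → A,
      (∀ l, ∃ n, 0 < n ∧ f l ∈ L n) ∧ AlgebraicIndependent k f)
    (hκ2 : ¬ ∃ f : Fin (κ + 2) → A,
      (∀ l, ∃ n, 0 < n ∧ f l ∈ L n) ∧ AlgebraicIndependent k f)
    (m : ℕ) (hm : 0 < m)
    (hidx : AddSubgroup.closure ((fun n : ℕ => (n : ℤ)) '' {n : ℕ | L n ≠ ⊥})
      = AddSubgroup.zmultiples (m : ℤ)) :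
    ∃ c : ℝ, Tendsto (fun n : ℕ => (Module.finrank k ↥(L (n * m)) : ℝ) / (n : ℝ) ^ κ)
      atTop (𝓝 c) := by
  let M : ℕ → Submodule k A := fun n => L (n * m)
  have : SetLike.GradedMonoid L :=
    { one_mem := hL1, mul_mem := fun i j x y hx hy => hLmul i j x hx y hy }
  have : SetLike.GradedMonoid M :=
    { one_mem := by simpa [M] using hL1
      mul_mem := fun i j x y hx hy => by
        simp only [M, add_mul]
        exact hLmul _ _ x hx y hy }
  have hfin𝒜 := GradedAlgebra.finiteDimensional_component 𝒜 hFT hA0 hgen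
  have hfin : ∀ n, FiniteDimensional k (M n) := fun n =>
    Submodule.finiteDimensional_of_le (hL (n * m))
  have h0 : (𝒜 0).FG := Module.Finite.iff_fg.1 hA0
  obtain ⟨O, d, w, F, C, h, hC⟩ := exists_isLatticeValue 𝒜 hFT h0
    (GradedAlgebra.fg_one 𝒜 hFT h0) (GradedAlgebra.le_mul_pow 𝒜 hgen)
  obtain ⟨s₀, hs₀⟩ := Submodule.exists_forall_mul_ne_bot L hidx
  obtain ⟨a, b, N, ha, hb, ha0, hb0, hli, hspan⟩ := h.exists_basis_valueGroup M
  refine tendsto_div_pow_of_superhomogeneous_of_le (fun n => Module.finrank k (M n))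
    (h.valueRank M) (∑ l, N l) s₀ κ (F * (2 * (C * m) + 1) ^ h.valueRank M) ?_ ?_ ?_
  · by_contra! hlt
    let e := Fin.castLE (Nat.succ_le_of_lt hlt)
    obtain ⟨f, D, hD, hf, hfi⟩ := h.exists_algebraicIndependent M 𝒜 hm (fun n => hL _)
      (Nat.succ_pos s₀) (hs₀ (s₀ + 1) (Nat.le_succ s₀) hm) (fun l => ha (e l)) (fun l => hb (e l))
      (fun l => ha0 (e l)) (fun l => hb0 (e l)) (hli.comp e (Fin.castLE_injective _))
    exact hκ2 ⟨f, fun l => ⟨D * m, Nat.mul_pos hD hm, hf l⟩, hfi⟩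
  · intro p j s hj hs
    exact h.pow_mul_finrank_le M ha hb ha0 hb0 hli hspan p j s hj (hs₀ s hs hm)
  · intro n
    have h1 := h.finrank_le M n (C * m) fun f hf hf0 i => ?_
    · refine (Nat.cast_le.2 h1).trans ?_
      push_cast
      rw [mul_assoc (F : ℝ), ← mul_pow]
      have hn : (0 : ℝ) ≤ n := n.cast_nonneg
      gcongr
      nlinarith
    · refine (hC _ f (hL _ hf) hf0 i).trans ?_
      push_cast
      have hm' : (1 : ℤ) ≤ m := by exact_mod_cast hm
      rw [mul_assoc]
      gcongr
      nlinarith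
end
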